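/- arXiv:1703.05178 — 6 statements merged into one kernel-verified Lean document; each statement's English description precedes it below -/
import Mathlib

section
/- For every f ∈ L²(ℝ; ℂ) there exists a sequence (fₙ) of functions in L²(ℝ; ℂ), each supported (almost everywhere) in a compact subset of [0, ∞), such that |𝓕fₙ|² converges to |𝓕f|² in L¹(ℝ) as n → ∞. -/
open MeasureTheory Filter Complex
open scoped FourierTransform

/-- Density lemma: for any `f ∈ L²(ℝ; ℂ)`, with Fourier–Plancherel transform `g`
(characterized as the `L²`-limit of the Fourier integrals of the truncations of `f`),
there is a sequence `(Fₙ)` of causal, compactly supported `L²` functions such that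
`|𝓕 Fₙ|²` converges to `|g|² = |𝓕 f|²` in `L¹(ℝ)`. -/
theorem causal_density_fourier_sq (f g : ℝ → ℂ)
    (hf : MemLp f 2 (volume : Measure ℝ))
    (hg : MemLp g 2 (volume : Measure ℝ))
    (hgdef : Tendsto
      (fun R : ℝ => eLpNorm
        (fun w : ℝ => g w - 𝓕 (Set.indicator (Set.Icc (-R) R) f) w) 2 (volume : Measure ℝ))
      atTop (nhds 0)) :
    ∃ F : ℕ → ℝ → ℂ,
      (∀ n : ℕ, MemLp (F n) 2 (volume : Measure ℝ) ∧
        ∃ T : ℝ, 0 ≤ T ∧ ∀ᵐ t : ℝ ∂(volume : Measure ℝ), F n t ≠ 0 → t ∈ Set.Icc 0 T) ∧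
      Tendsto (fun n : ℕ => ∫ w : ℝ, |‖𝓕 (F n) w‖ ^ 2 - ‖g w‖ ^ 2|)
        atTop (nhds 0) := by
  have hint : ∀ n : ℕ, MemLp (Set.indicator (Set.Icc (-(n:ℝ)) n) f) 2 volume := fun n =>
    hf.indicator measurableSet_Icc
  have hint1 : ∀ n : ℕ, Integrable (Set.indicator (Set.Icc (-(n:ℝ)) n) f) volume := fun n => by
    rw [integrable_indicator_iff measurableSet_Icc]
    have : IsFiniteMeasure (volume.restrict (Set.Icc (-(n:ℝ)) n)) :=
      ⟨by simp⟩
    exact (hf.restrict _).integrable (by norm_num)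
  refine ⟨fun n t => Set.indicator (Set.Icc (-(n:ℝ)) n) f (t + (-(n:ℝ))), fun n => ⟨?_, ?_⟩, ?_⟩
  · exact (hint n).comp_measurePreserving (measurePreserving_add_right volume (-(n:ℝ)))
  · refine ⟨2 * n, by positivity, ae_of_all _ fun t ht => ?_⟩
    have := Set.mem_of_indicator_ne_zero ht
    simp only [Set.mem_Icc] at this ⊢
    constructor <;> linarith [this.1, this.2]
  · have hshift : ∀ (n : ℕ) (w : ℝ),
        ‖𝓕 (fun t => Set.indicator (Set.Icc (-(n:ℝ)) n) f (t + (-(n:ℝ)))) w‖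
          = ‖𝓕 (Set.indicator (Set.Icc (-(n:ℝ)) n) f) w‖ := by
      intro n w
      have h := congrFun (VectorFourier.fourierIntegral_comp_add_right Real.fourierChar volume
        (innerₗ ℝ) (Set.indicator (Set.Icc (-(n:ℝ)) n) f) (-(n:ℝ))) w
      change 𝓕 (fun t => Set.indicator (Set.Icc (-(n:ℝ)) n) f (t + (-(n:ℝ)))) w = _ at h
      rw [h, Circle.norm_smul]
      rfl
    simp only [hshift]
    have hcont : ∀ n : ℕ, Continuous (𝓕 (Set.indicator (Set.Icc (-(n:ℝ)) n) f)) := fun n =>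
      VectorFourier.fourierIntegral_continuous Real.continuous_fourierChar
        continuous_inner (hint1 n)
    have hd := hgdef.comp tendsto_natCast_atTop_atTop (α := ℕ)
    rw [tendsto_zero_iff_enorm_tendsto_zero]
    have hlim : Tendsto (fun n : ℕ =>
        eLpNorm (fun w : ℝ => g w - 𝓕 (Set.indicator (Set.Icc (-(n:ℝ)) n) f) w) 2 volume *
        (eLpNorm (fun w : ℝ => g w - 𝓕 (Set.indicator (Set.Icc (-(n:ℝ)) n) f) w) 2 volume
          + (eLpNorm g 2 volume + eLpNorm g 2 volume))) atTop (nhds 0) := by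
      have hG := hg.eLpNorm_ne_top
      have := ENNReal.Tendsto.mul hd (Or.inr (by simp [hG]))
        (hd.add (tendsto_const_nhds (x := eLpNorm g 2 volume + eLpNorm g 2 volume)))
        (Or.inr (by simp))
      simpa using this
    refine tendsto_of_tendsto_of_tendsto_of_le_of_le tendsto_const_nhds hlim
      (fun _ => zero_le) fun n => ?_
    set a := 𝓕 (Set.indicator (Set.Icc (-(n:ℝ)) n) f) with ha
    have hdm : AEStronglyMeasurable (fun w => g w - a w) volume :=
      hg.1.sub (hcont n).aestronglyMeasurable
    have hgn : AEStronglyMeasurable (fun w => ‖g w‖) volume := hg.1.norm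
    calc _ ≤ ∫⁻ w, ‖|‖a w‖ ^ 2 - ‖g w‖ ^ 2|‖ₑ := enorm_integral_le_lintegral_enorm _
      _ = eLpNorm (fun w => |‖a w‖ ^ 2 - ‖g w‖ ^ 2|) 1 volume := eLpNorm_one_eq_lintegral_enorm.symm
      _ ≤ eLpNorm ((fun w => ‖g w - a w‖) • (fun w => ‖g w - a w‖ + (‖g w‖ + ‖g w‖))) 1 volume := by
        refine eLpNorm_mono_real fun w => ?_
        have h1 : ‖a w‖ ≤ ‖g w - a w‖ + ‖g w‖ := by
          have := norm_sub_le (g w) (g w - a w)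
          rw [sub_sub_cancel] at this; linarith
        have h2 : ‖g w‖ ≤ ‖g w - a w‖ + ‖a w‖ := by
          have := norm_add_le (g w - a w) (a w)
          rwa [sub_add_cancel] at this
        simp only [Pi.smul_apply', smul_eq_mul, Real.norm_eq_abs, abs_abs]
        have e : ‖a w‖ ^ 2 - ‖g w‖ ^ 2 = (‖a w‖ - ‖g w‖) * (‖a w‖ + ‖g w‖) := by ring
        rw [e, abs_mul, abs_of_nonneg (by positivity : 0 ≤ ‖a w‖ + ‖g w‖)]
        exact mul_le_mul (abs_le.2 ⟨by linarith, by linarith⟩) (by linarith) (by positivity)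
          (by positivity)
      _ ≤ eLpNorm (fun w => ‖g w - a w‖) 2 volume *
          eLpNorm (fun w => ‖g w - a w‖ + (‖g w‖ + ‖g w‖)) 2 volume :=
        eLpNorm_smul_le_mul_eLpNorm (hdm.norm.add (hgn.add hgn)) hdm.norm
      _ ≤ _ := by
        rw [eLpNorm_norm]
        gcongr
        refine (eLpNorm_add_le hdm.norm (hgn.add hgn) (by norm_num)).trans ?_
        rw [eLpNorm_norm]
        gcongr
        refine (eLpNorm_add_le hgn hgn (by norm_num)).trans ?_
        rw [eLpNorm_norm]
end

section
/- Let ε₀ > 0 and let ε : ℂ → ℂ be continuous on the closed upper half-plane {Im ω ≥ 0}, analytic on the open upper half-plane ℂ⁺, satisfy Im(ω ε(ω)) ≥ 0 for every real ω, and satisfy ω (ε(ω) − ε₀) → 0 as |ω| → ∞ within {Im ω ≥ 0}. Then Im(ω ε(ω)) ≥ ε₀ · Im ω for every ω ∈ ℂ⁺; in particular ω ↦ ω ε(ω) is a Herglotz function. -/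
open Complex Filter

/-- A Herglotz function: a function analytic on the open upper half-plane
`ℂ⁺ = {ω : ℂ | 0 < ω.im}` whose imaginary part is nonnegative there. -/
def IsHerglotz (f : ℂ → ℂ) : Prop :=
  DifferentiableOn ℂ f {z : ℂ | 0 < z.im} ∧ ∀ z : ℂ, 0 < z.im → 0 ≤ (f z).im

/-- If `ε` is continuous on the closed upper half-plane, analytic on the open upper half-plane,
satisfies `Im (ω ε(ω)) ≥ 0` on the real axis, and `ω (ε(ω) - ε₀) → 0` as `|ω| → ∞` within the
closed upper half-plane, then `Im (ω ε(ω)) ≥ ε₀ Im ω` on `ℂ⁺`; in particular `ω ↦ ω ε(ω)` is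
a Herglotz function. -/
theorem herglotz_of_nonneg_on_real (ε₀ : ℝ) (hε₀ : 0 < ε₀) (ε : ℂ → ℂ)
    (hcont : ContinuousOn ε {z : ℂ | 0 ≤ z.im})
    (hdiff : DifferentiableOn ℂ ε {z : ℂ | 0 < z.im})
    (hreal : ∀ x : ℝ, 0 ≤ ((x : ℂ) * ε (x : ℂ)).im)
    (hHF : Tendsto (fun ω : ℂ => ω * (ε ω - (ε₀ : ℂ)))
      (Filter.comap (fun z : ℂ => ‖z‖) Filter.atTop ⊓ Filter.principal {z : ℂ | 0 ≤ z.im})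
      (nhds 0)) :
    (∀ ω : ℂ, 0 < ω.im → ε₀ * ω.im ≤ (ω * ε ω).im) ∧
      IsHerglotz (fun ω : ℂ => ω * ε ω) := by
  have hclU : ∀ r : ℝ, closure ({z : ℂ | 0 < z.im} ∩ Metric.ball 0 r) ⊆
      {z : ℂ | 0 ≤ z.im} ∩ Metric.closedBall 0 r := by
    intro r
    apply closure_minimal
    · rintro z ⟨h1, h2⟩
      have h3 : 0 < z.im := h1
      have h4 : 0 ≤ z.im := h3.le
      exact ⟨h4, Metric.ball_subset_closedBall h2⟩
    · exact (isClosed_le continuous_const Complex.continuous_im).inter Metric.isClosed_closedBall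
  have hopen : IsOpen {z : ℂ | 0 < z.im} := isOpen_lt continuous_const Complex.continuous_im
  have key : ∀ ω : ℂ, 0 < ω.im → 0 ≤ (ω * (ε ω - (ε₀ : ℂ))).im := by
    intro ω hω
    apply le_of_forall_pos_le_add
    intro δ hδ
    have hev := hHF.eventually (Metric.ball_mem_nhds (0 : ℂ) hδ)
    rw [Filter.eventually_inf_principal, Filter.eventually_comap] at hev
    obtain ⟨R, hR⟩ := Filter.eventually_atTop.1 hev
    set r : ℝ := max R (‖ω‖ + 1) with hr
    have hUo : IsOpen ({z : ℂ | 0 < z.im} ∩ Metric.ball 0 r) := hopen.inter Metric.isOpen_ball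
    have hd : DiffContOnCl ℂ (fun z : ℂ => Complex.exp (Complex.I * (z * (ε z - (ε₀ : ℂ)))))
        ({z : ℂ | 0 < z.im} ∩ Metric.ball 0 r) := by
      constructor
      · have h1 : DifferentiableOn ℂ ε ({z : ℂ | 0 < z.im} ∩ Metric.ball 0 r) :=
          hdiff.mono Set.inter_subset_left
        fun_prop
      · have h1 : ContinuousOn ε (closure ({z : ℂ | 0 < z.im} ∩ Metric.ball 0 r)) :=
          hcont.mono ((hclU r).trans Set.inter_subset_left)
        fun_prop
    have hmem : ω ∈ {z : ℂ | 0 < z.im} ∩ Metric.ball 0 r := by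
      refine ⟨hω, ?_⟩
      rw [mem_ball_zero_iff]
      exact lt_of_lt_of_le (lt_add_one _) (le_max_right _ _)
    have hb := Complex.norm_le_of_forall_mem_frontier_norm_le (C := Real.exp δ)
      (Metric.isBounded_ball.subset Set.inter_subset_right) hd ?_ (subset_closure hmem)
    · rw [Complex.norm_exp, Real.exp_le_exp, Complex.I_mul_re] at hb
      linarith
    · intro z hz
      rw [hUo.frontier_eq] at hz
      obtain ⟨hz1, hz2⟩ := hz
      obtain ⟨hz3, hz4⟩ := hclU r hz1
      have hz3' : 0 ≤ z.im := hz3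
      rw [mem_closedBall_zero_iff] at hz4
      rw [Complex.norm_exp, Real.exp_le_exp, Complex.I_mul_re]
      rcases hz3'.eq_or_lt with h0 | h0
      · have hzr : ((z.re : ℝ) : ℂ) = z := Complex.ext (by simp) (by simpa using h0)
        have h2 := hreal z.re
        rw [hzr] at h2
        have h3 : (z * (ε z - (ε₀ : ℂ))).im = (z * ε z).im := by
          rw [mul_sub, Complex.sub_im]
          simp [← h0]
        rw [h3]
        linarith
      · have hzn : r ≤ ‖z‖ := by
          by_contra h
          exact hz2 ⟨h0, by rw [mem_ball_zero_iff]; exact not_le.1 h⟩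
        have h4 := hR ‖z‖ ((le_max_left _ _).trans hzn) z rfl hz3
        replace h4 : z * (ε z - (ε₀ : ℂ)) ∈ Metric.ball (0 : ℂ) δ := h4
        rw [mem_ball_zero_iff] at h4
        have h5 := Complex.abs_im_le_norm (z * (ε z - (ε₀ : ℂ)))
        have h6 := neg_abs_le (z * (ε z - (ε₀ : ℂ))).im
        linarith
  have main : ∀ ω : ℂ, 0 < ω.im → ε₀ * ω.im ≤ (ω * ε ω).im := by
    intro ω hω
    have h := key ω hω
    rw [mul_sub, Complex.sub_im, Complex.im_mul_ofReal] at h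
    linarith
  refine ⟨main, ?_, ?_⟩
  · fun_prop
  · intro z hz
    exact (mul_pos hε₀ hz).le.trans (main z hz)
end

section
/- Let ε and μ be rational functions with complex coefficients such that ε(ω) → ε₀ > 0 and μ(ω) → μ₀ > 0 as |ω| → ∞, satisfying the reality principle ε(−conj(ω)) = conj(ε(ω)) and μ(−conj(ω)) = conj(μ(ω)), and such that the rational function F(ω) = ω² ε(ω) μ(ω) is non-degenerate, i.e. no pole of ε is a zero of ω μ(ω) and no pole of μ is a zero of ω ε(ω). Assume the medium is non-dissipative: for every real r > 0, every complex solution ω of F(ω) = r is real. Then every pole and every zero of F is real and has multiplicity at most 2; in particular ω = 0 is not a zero of ε or of μ. -/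
open Polynomial Filter

open Topology in
/-- Core local lemma, proved by the intermediate value theorem on a small arc. -/
lemma core_arc (m : ℕ) (hm : 1 ≤ m) (g : ℂ → ℂ) (z u : ℂ)
    (hg : ∀ᶠ w in 𝓝 z, ContinuousAt g w) (hu : u ^ m * g z = 1)
    (hN : ∃ d > 0, ∀ ρ s : ℝ, 0 < ρ → ρ < d → |s| < d →
      (z + ρ * u * Complex.exp (s * Complex.I)).im ≠ 0)
    (H : ∀ᶠ w in 𝓝[≠] z, ∀ r : ℝ, 0 < r → (w - z) ^ m * g w = (r : ℂ) → w.im = 0) :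
    False := by
  obtain ⟨d, hd, hN⟩ := hN
  have hm0 : (0 : ℝ) < m := by exact_mod_cast hm
  have hu0 : u ≠ 0 := by
    rintro rfl
    rw [zero_pow (by omega)] at hu
    simp at hu
  obtain ⟨δ, hδ, hδd, hδm⟩ : ∃ δ : ℝ, 0 < δ ∧ δ < d ∧ m * δ < Real.pi / 2 := by
    refine ⟨min (d / 2) (Real.pi / (4 * m)), by positivity, ?_, ?_⟩
    · exact (min_le_left _ _).trans_lt (by linarith)
    · calc m * min (d / 2) (Real.pi / (4 * m)) ≤ m * (Real.pi / (4 * m)) := by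
            gcongr; exact min_le_right _ _
        _ = Real.pi / 4 := by field_simp
        _ < Real.pi / 2 := by linarith [Real.pi_pos]
  have hmδ : 0 < m * δ := by positivity
  have ha : 0 < Real.cos (m * δ) := Real.cos_pos_of_mem_Ioo ⟨by linarith, hδm⟩
  have hb : 0 < Real.sin (m * δ) := Real.sin_pos_of_pos_of_lt_pi hmδ (by linarith [Real.pi_pos])
  set η := min (Real.cos (m * δ)) (Real.sin (m * δ)) with hη
  have hη0 : 0 < η := lt_min ha hb
  have hcont : ContinuousAt (fun w => u ^ m * g w) z := continuousAt_const.mul hg.self_of_nhds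
  have hclose : ∀ᶠ w in 𝓝 z, ‖u ^ m * g w - 1‖ < η := by
    have := Metric.continuousAt_iff'.1 hcont η hη0
    simpa [hu, dist_eq_norm] using this
  have H' := eventually_nhdsWithin_iff.1 H
  obtain ⟨R, hR, hball⟩ := Metric.eventually_nhds_iff.1 ((hg.and hclose).and H')
  obtain ⟨ρ, hρ, hρd, hρR⟩ : ∃ ρ : ℝ, 0 < ρ ∧ ρ < d ∧ ρ * ‖u‖ < R := by
    have hun : 0 < ‖u‖ := norm_pos_iff.2 hu0
    refine ⟨min (d / 2) (R / (2 * ‖u‖)), by positivity, ?_, ?_⟩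
    · exact (min_le_left _ _).trans_lt (by linarith)
    · calc min (d / 2) (R / (2 * ‖u‖)) * ‖u‖ ≤ (R / (2 * ‖u‖)) * ‖u‖ := by
            gcongr; exact min_le_right _ _
        _ = R / 2 := by field_simp
        _ < R := by linarith
  let w : ℝ → ℂ := fun s => z + ρ * u * Complex.exp (s * Complex.I)
  have hwc : Continuous w := by fun_prop
  have hwb : ∀ s, dist (w s) z < R := by
    intro s
    simp [w, dist_eq_norm, Complex.norm_exp_ofReal_mul_I, abs_of_pos hρ, hρR]
  have hwne : ∀ s, w s ≠ z := by
    intro s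
    simp [w, hu0, hρ.ne', Complex.exp_ne_zero]
  let G : ℝ → ℂ := fun s => u ^ m * g (w s)
  have hGc : Continuous G := by
    rw [continuous_iff_continuousAt]
    intro s
    exact continuousAt_const.mul
      (ContinuousAt.comp (f := w) (g := g) (hball (hwb s)).1.1 hwc.continuousAt)
  have hG1 : ∀ s, ‖G s - 1‖ < η := fun s => (hball (hwb s)).1.2
  let E : ℝ → ℂ := fun s => Complex.exp (((m * s : ℝ) : ℂ) * Complex.I)
  have hEc : Continuous E := by fun_prop
  have hdiff : ∀ s, ‖E s * G s - E s‖ < η := by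
    intro s
    have : E s * G s - E s = E s * (G s - 1) := by ring
    rw [this, norm_mul, Complex.norm_exp_ofReal_mul_I, one_mul]
    exact hG1 s
  have hEre : ∀ s, (E s).re = Real.cos (m * s) := fun s => Complex.exp_ofReal_mul_I_re _
  have hEim : ∀ s, (E s).im = Real.sin (m * s) := fun s => Complex.exp_ofReal_mul_I_im _
  have hre : ∀ s, |s| ≤ δ → 0 < (E s * G s).re := by
    intro s hs
    have h1 := (Complex.abs_re_le_norm _).trans_lt (hdiff s)
    rw [Complex.sub_re, hEre, abs_lt] at h1
    have h2 : Real.cos (m * δ) ≤ Real.cos (m * s) := by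
      rw [← Real.cos_abs (m * s)]
      apply Real.cos_le_cos_of_nonneg_of_le_pi (abs_nonneg _) (by linarith [Real.pi_pos])
      rw [abs_mul, abs_of_pos hm0]
      gcongr
    have := min_le_left (Real.cos (m * δ)) (Real.sin (m * δ))
    linarith [h1.1]
  have him1 : 0 < (E δ * G δ).im := by
    have h1 := (Complex.abs_im_le_norm _).trans_lt (hdiff δ)
    rw [Complex.sub_im, hEim, abs_lt] at h1
    have := min_le_right (Real.cos (m * δ)) (Real.sin (m * δ))
    linarith [h1.1]
  have him2 : (E (-δ) * G (-δ)).im < 0 := by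
    have h1 := (Complex.abs_im_le_norm _).trans_lt (hdiff (-δ))
    rw [Complex.sub_im, hEim, abs_lt, mul_neg, Real.sin_neg] at h1
    have := min_le_right (Real.cos (m * δ)) (Real.sin (m * δ))
    linarith [h1.2]
  have hfc : Continuous (fun s => (E s * G s).im) :=
    Complex.continuous_im.comp (hEc.mul hGc)
  obtain ⟨s, hs, hs0⟩ := intermediate_value_Icc (by linarith : -δ ≤ δ) hfc.continuousOn
    (show (0 : ℝ) ∈ Set.Icc _ _ from ⟨him2.le, him1.le⟩)
  have hsδ : |s| ≤ δ := abs_le.2 hs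
  refine hN ρ s hρ hρd (hsδ.trans_lt hδd) ?_
  refine (hball (hwb s)).2 (hwne s) (ρ ^ m * (E s * G s).re)
    (mul_pos (pow_pos hρ m) (hre s hsδ)) ?_
  have h1 : (((E s * G s).re : ℝ) : ℂ) = E s * G s := by
    exact Complex.ext (Complex.ofReal_re _) ((Complex.ofReal_im _).trans hs0.symm)
  push_cast
  rw [h1]
  have h2 : E s = Complex.exp (s * Complex.I) ^ m := by
    simp only [E]
    rw [← Complex.exp_nat_mul]
    congr 1
    push_cast
    ring
  rw [h2]
  simp only [G, w]
  rw [add_sub_cancel_left]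
  ring

open Topology in
/-- Local conclusion at a zero of order `m ≥ 1`. -/
lemma core_local (m : ℕ) (hm : 1 ≤ m) (g : ℂ → ℂ) (z : ℂ)
    (hg : ∀ᶠ w in 𝓝 z, ContinuousAt g w) (hgz : g z ≠ 0)
    (H : ∀ᶠ w in 𝓝[≠] z, ∀ r : ℝ, 0 < r → (w - z) ^ m * g w = (r : ℂ) → w.im = 0) :
    z.im = 0 ∧ m ≤ 2 := by
  obtain ⟨u, hu⟩ := IsAlgClosed.exists_pow_nat_eq (g z)⁻¹ (show 0 < m by omega)
  have hu1 : u ^ m * g z = 1 := by rw [hu, inv_mul_cancel₀ hgz]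
  have hu0 : u ≠ 0 := by
    rintro rfl
    rw [zero_pow (by omega)] at hu1
    simp at hu1
  by_cases hz : z.im = 0
  · refine ⟨hz, ?_⟩
    by_contra hm2
    have key : ∀ v : ℂ, v ^ m * g z = 1 → v.im = 0 := by
      intro v hv
      by_contra hvi
      have hc : Continuous (fun s : ℝ => (v * Complex.exp (s * Complex.I)).im) := by fun_prop
      have : ∀ᶠ s : ℝ in 𝓝 (0 : ℝ), (v * Complex.exp ((s : ℂ) * Complex.I)).im ≠ 0 := by
        apply hc.continuousAt.eventually_ne
        simpa using hvi
      obtain ⟨d, hd, hdd⟩ := Metric.eventually_nhds_iff.1 this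
      refine core_arc m hm g z v hg hv ⟨d, hd, ?_⟩ H
      intro ρ s hρ _ hs
      rw [mul_assoc, Complex.add_im, hz, zero_add, Complex.im_ofReal_mul]
      exact mul_ne_zero hρ.ne' (hdd (by simpa using hs))
    have h1 := key u hu1
    have hprim := Complex.isPrimitiveRoot_exp m (by omega)
    have h2 := key (u * Complex.exp (2 * Real.pi * Complex.I / m)) (by
      rw [mul_pow, hprim.pow_eq_one, mul_one, hu1])
    have hure : u.re ≠ 0 := fun h => hu0 (Complex.ext h h1)
    rw [Complex.mul_im, h1, zero_mul, add_zero] at h2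
    have h3 := (mul_eq_zero.1 h2).resolve_left hure
    have h4 : (2 * Real.pi * Complex.I / m : ℂ) = ((2 * Real.pi / m : ℝ) : ℂ) * Complex.I := by
      push_cast; ring
    rw [h4, Complex.exp_ofReal_mul_I_im] at h3
    have hm3 : (3 : ℝ) ≤ m := by exact_mod_cast (by omega : 3 ≤ m)
    refine (Real.sin_pos_of_pos_of_lt_pi (by positivity) ?_).ne' h3
    rw [div_lt_iff₀ (by positivity)]
    nlinarith [Real.pi_pos]
  · exfalso
    have hun : 0 < ‖u‖ := norm_pos_iff.2 hu0
    have hzp : 0 < |z.im| := abs_pos.2 hz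
    refine core_arc m hm g z u hg hu1 ⟨|z.im| / ‖u‖, by positivity, ?_⟩ H
    intro ρ s hρ hρd _ h
    rw [Complex.add_im] at h
    have h1 := Complex.abs_im_le_norm (ρ * u * Complex.exp (s * Complex.I))
    rw [norm_mul, Complex.norm_exp_ofReal_mul_I, norm_mul, Complex.norm_real, Real.norm_eq_abs,
      abs_of_pos hρ, mul_one] at h1
    rw [lt_div_iff₀ hun] at hρd
    have h2 : z.im = -(ρ * u * Complex.exp (s * Complex.I)).im := by linarith
    rw [h2, abs_neg] at hρd
    linarith

open Topology in
lemma core_poly (P Q : ℂ[X]) (hP : P ≠ 0) (z : ℂ) (hPz : P.eval z = 0) (hQz : Q.eval z ≠ 0)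
    (H : ∀ᶠ w in 𝓝[≠] z, ∀ r : ℝ, 0 < r → P.eval w / Q.eval w = (r : ℂ) → w.im = 0) :
    z.im = 0 ∧ P.rootMultiplicity z ≤ 2 := by
  obtain ⟨P₁, hP₁, hnd⟩ := Polynomial.exists_eq_pow_rootMultiplicity_mul_and_not_dvd P hP z
  have hP₁z : P₁.eval z ≠ 0 := fun h => hnd (Polynomial.dvd_iff_isRoot.2 h)
  refine core_local (P.rootMultiplicity z) ?_ (fun w => P₁.eval w / Q.eval w) z ?_
    (div_ne_zero hP₁z hQz) ?_
  · exact (Polynomial.rootMultiplicity_pos hP).2 hPz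
  · filter_upwards [Q.continuous.continuousAt.eventually_ne hQz] with w hw
    exact P₁.continuous.continuousAt.div Q.continuous.continuousAt hw
  · filter_upwards [H] with w hw r hr h
    refine hw r hr ?_
    rw [← h]
    conv_lhs => rw [hP₁]
    simp [mul_div_assoc]

open Topology in
lemma ev_ne (P : ℂ[X]) (hP : P ≠ 0) (z : ℂ) : ∀ᶠ w in 𝓝[≠] z, P.eval w ≠ 0 := by
  have h1 : (P.roots.toFinset : Set ℂ).Finite := Finset.finite_toSet _
  have := (h1.subset (Set.sdiff_subset (t := {z}))).isClosed.isOpen_compl.mem_nhds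
    (show z ∈ ((P.roots.toFinset : Set ℂ) \ {z})ᶜ by simp)
  filter_upwards [mem_nhdsWithin_of_mem_nhds this, self_mem_nhdsWithin] with w hw hwz h
  exact hw ⟨by simpa [hP] using h, hwz⟩

lemma num_ne_of_denom {f : RatFunc ℂ} {z : ℂ} (h1 : f.denom.eval z = 0)
    (h2 : f.num.eval z = 0) : False := by
  obtain ⟨a, b, hab⟩ := RatFunc.isCoprime_num_denom f
  have := congrArg (Polynomial.eval z) hab
  simp [h1, h2] at this

lemma ne_zero_of_lim (ε : RatFunc ℂ) (ε₀ : ℝ) (hε₀ : 0 < ε₀)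
    (h : Tendsto (fun z : ℂ => RatFunc.eval (RingHom.id ℂ) z ε)
      (Filter.comap (norm : ℂ → ℝ) Filter.atTop) (nhds (ε₀ : ℂ))) : ε ≠ 0 := by
  rintro rfl
  rw [comap_norm_atTop] at h
  simp only [RatFunc.eval_zero] at h
  have := tendsto_nhds_unique h tendsto_const_nhds
  exact hε₀.ne' (by exact_mod_cast this)

/-- If `ε` vanishes at `0`, then `F` has a zero of order at least three there. -/
lemma zero_mult (ε μ : RatFunc ℂ) (hε : ε ≠ 0) (hμ : μ ≠ 0)
    (hnd : ∀ z : ℂ, Polynomial.eval z μ.denom = 0 →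
      Polynomial.eval z (RatFunc.X * ε).num ≠ 0)
    (h0 : ε.num.eval 0 = 0) :
    (RatFunc.X ^ 2 * ε * μ).num.eval 0 = 0 ∧
      3 ≤ (RatFunc.X ^ 2 * ε * μ).num.rootMultiplicity 0 := by
  have hεd : ε.denom.eval 0 ≠ 0 := fun h => num_ne_of_denom h h0
  have hXε := RatFunc.num_denom_mul RatFunc.X ε
  simp only [RatFunc.num_X, RatFunc.denom_X, one_mul] at hXε
  have hμd : μ.denom.eval 0 ≠ 0 := by
    intro h
    apply hnd 0 h
    have := congrArg (Polynomial.eval 0) hXε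
    simpa [hεd] using this
  have hF0 : (RatFunc.X ^ 2 * ε * μ) ≠ 0 := by simp [hε, hμ, RatFunc.X_ne_zero]
  set F := RatFunc.X ^ 2 * ε * μ with hF
  have hkey : F.num * (ε.denom * μ.denom) = X ^ 2 * ε.num * μ.num * F.denom := by
    apply RatFunc.algebraMap_injective ℂ
    have e1 := RatFunc.num_div_denom F
    have e2 := RatFunc.num_div_denom ε
    have e3 := RatFunc.num_div_denom μ
    have n1 := RatFunc.algebraMap_ne_zero (RatFunc.denom_ne_zero F)
    have n2 := RatFunc.algebraMap_ne_zero (RatFunc.denom_ne_zero ε)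
    have n3 := RatFunc.algebraMap_ne_zero (RatFunc.denom_ne_zero μ)
    rw [div_eq_iff n1] at e1
    rw [div_eq_iff n2] at e2
    rw [div_eq_iff n3] at e3
    simp only [map_mul, map_pow, RatFunc.algebraMap_X]
    rw [e1, e2, e3, hF]
    ring
  have hdvd : (X : ℂ[X]) ^ 3 ∣ F.num * (ε.denom * μ.denom) := by
    obtain ⟨q, hq⟩ := Polynomial.X_dvd_iff.2 (by rwa [Polynomial.coeff_zero_eq_eval_zero] :
      ε.num.coeff 0 = 0)
    rw [hkey, hq]
    exact ⟨q * μ.num * F.denom, by ring⟩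
  have hcop : IsCoprime ((X : ℂ[X]) ^ 3) (ε.denom * μ.denom) := by
    apply IsCoprime.pow_left
    rw [Polynomial.irreducible_X.coprime_iff_not_dvd, Polynomial.X_dvd_iff,
      Polynomial.coeff_zero_eq_eval_zero]
    simp [hεd, hμd]
  have hd := hcop.dvd_of_dvd_mul_right hdvd
  have hn0 : F.num ≠ 0 := RatFunc.num_ne_zero hF0
  have h3 : 3 ≤ F.num.rootMultiplicity 0 := by
    rw [Polynomial.le_rootMultiplicity_iff hn0]
    simpa using hd
  exact ⟨(Polynomial.rootMultiplicity_pos hn0).1 (by omega), h3⟩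

/-- For a non-degenerate, non-dissipative local material `(ε, μ)` (rational, tending to
`ε₀, μ₀ > 0` at infinity and satisfying the reality principle), all poles and zeros of
`F(ω) = ω² ε(ω) μ(ω)` are real with multiplicity at most `2`; in particular `ω = 0` is not
a zero of `ε` or of `μ`. -/
theorem nondissipative_poles_zeros_real_mult_le_two
    (ε μ : RatFunc ℂ) (ε₀ μ₀ : ℝ) (hε₀ : 0 < ε₀) (hμ₀ : 0 < μ₀)
    (hεlim : Tendsto (fun z : ℂ => RatFunc.eval (RingHom.id ℂ) z ε)
      (Filter.comap (norm : ℂ → ℝ) Filter.atTop) (nhds (ε₀ : ℂ)))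
    (hμlim : Tendsto (fun z : ℂ => RatFunc.eval (RingHom.id ℂ) z μ)
      (Filter.comap (norm : ℂ → ℝ) Filter.atTop) (nhds (μ₀ : ℂ)))
    (hεreal : ∀ z : ℂ, Polynomial.eval z ε.denom ≠ 0 →
      RatFunc.eval (RingHom.id ℂ) (-(starRingEnd ℂ z)) ε
        = starRingEnd ℂ (RatFunc.eval (RingHom.id ℂ) z ε))
    (hμreal : ∀ z : ℂ, Polynomial.eval z μ.denom ≠ 0 →
      RatFunc.eval (RingHom.id ℂ) (-(starRingEnd ℂ z)) μ
        = starRingEnd ℂ (RatFunc.eval (RingHom.id ℂ) z μ))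
    -- non-degeneracy: no pole of ε is a zero of ω μ(ω), no pole of μ is a zero of ω ε(ω)
    (hnd₁ : ∀ z : ℂ, Polynomial.eval z ε.denom = 0 →
      Polynomial.eval z (RatFunc.X * μ).num ≠ 0)
    (hnd₂ : ∀ z : ℂ, Polynomial.eval z μ.denom = 0 →
      Polynomial.eval z (RatFunc.X * ε).num ≠ 0)
    -- non-dissipativity: every solution of the dispersion relation ω² ε(ω) μ(ω) = r is real
    (hnondis : ∀ r : ℝ, 0 < r → ∀ ω : ℂ,
      Polynomial.eval ω ε.denom ≠ 0 → Polynomial.eval ω μ.denom ≠ 0 →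
      ω ^ 2 * RatFunc.eval (RingHom.id ℂ) ω ε * RatFunc.eval (RingHom.id ℂ) ω μ = (r : ℂ) →
      ω.im = 0) :
    (∀ z : ℂ, Polynomial.eval z (RatFunc.X ^ 2 * ε * μ).denom = 0 →
        z.im = 0 ∧ Polynomial.rootMultiplicity z (RatFunc.X ^ 2 * ε * μ).denom ≤ 2) ∧
    (∀ z : ℂ, Polynomial.eval z (RatFunc.X ^ 2 * ε * μ).num = 0 →
        z.im = 0 ∧ Polynomial.rootMultiplicity z (RatFunc.X ^ 2 * ε * μ).num ≤ 2) ∧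
    Polynomial.eval 0 ε.num ≠ 0 ∧ Polynomial.eval 0 μ.num ≠ 0 := by
  have hε := ne_zero_of_lim ε ε₀ hε₀ hεlim
  have hμ := ne_zero_of_lim μ μ₀ hμ₀ hμlim
  have hF0 : (RatFunc.X ^ 2 * ε * μ) ≠ 0 := by simp [hε, hμ, RatFunc.X_ne_zero]
  have hn0 := RatFunc.num_ne_zero hF0
  have hd0 := RatFunc.denom_ne_zero (RatFunc.X ^ 2 * ε * μ)
  have hev : ∀ w : ℂ, ε.denom.eval w ≠ 0 → μ.denom.eval w ≠ 0 →
      (RatFunc.X ^ 2 * ε * μ).num.eval w / (RatFunc.X ^ 2 * ε * μ).denom.eval w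
        = w ^ 2 * RatFunc.eval (RingHom.id ℂ) w ε * RatFunc.eval (RingHom.id ℂ) w μ := by
    intro w h1 h2
    have hX : ∀ n : ℕ, (RatFunc.X ^ n : RatFunc ℂ) = algebraMap ℂ[X] (RatFunc ℂ) (X ^ n) := by
      intro n; simp
    have hX2 : Polynomial.eval₂ (RingHom.id ℂ) w (RatFunc.X ^ 2 : RatFunc ℂ).denom ≠ 0 := by
      rw [hX, RatFunc.denom_algebraMap]; simp
    have hXε : Polynomial.eval₂ (RingHom.id ℂ) w (RatFunc.X ^ 2 * ε : RatFunc ℂ).denom ≠ 0 := by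
      intro h
      have h3 := Polynomial.eval₂_eq_zero_of_dvd_of_eval₂_eq_zero (RingHom.id ℂ) w
        (RatFunc.denom_mul_dvd (RatFunc.X ^ 2) ε) h
      rw [Polynomial.eval₂_mul] at h3
      exact (mul_ne_zero hX2 (by simpa [Polynomial.eval₂_id] using h1)) h3
    have e1 : RatFunc.eval (RingHom.id ℂ) w (RatFunc.X ^ 2 * ε * μ) =
        w ^ 2 * RatFunc.eval (RingHom.id ℂ) w ε * RatFunc.eval (RingHom.id ℂ) w μ := by
      have h1' : Polynomial.eval₂ (RingHom.id ℂ) w ε.denom ≠ 0 := by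
        simpa [Polynomial.eval₂_id] using h1
      have h2' : Polynomial.eval₂ (RingHom.id ℂ) w μ.denom ≠ 0 := by
        simpa [Polynomial.eval₂_id] using h2
      rw [RatFunc.eval_mul (RingHom.id ℂ) w hXε h2', RatFunc.eval_mul (RingHom.id ℂ) w hX2 h1', hX,
        RatFunc.eval_algebraMap]
      simp
    rw [← e1]
    simp [RatFunc.eval, Polynomial.eval₂_id]
  have hzero : ∀ z : ℂ, Polynomial.eval z (RatFunc.X ^ 2 * ε * μ).num = 0 →
      z.im = 0 ∧ Polynomial.rootMultiplicity z (RatFunc.X ^ 2 * ε * μ).num ≤ 2 := by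
    intro z hz
    refine core_poly _ (RatFunc.X ^ 2 * ε * μ).denom hn0 z hz (fun h => num_ne_of_denom h hz) ?_
    filter_upwards [ev_ne ε.denom (RatFunc.denom_ne_zero _) z,
      ev_ne μ.denom (RatFunc.denom_ne_zero _) z] with w h1 h2 r hr h
    exact hnondis r hr w h1 h2 (by rw [← hev w h1 h2, h])
  refine ⟨?_, hzero, ?_, ?_⟩
  · intro z hz
    refine core_poly _ (RatFunc.X ^ 2 * ε * μ).num hd0 z hz (fun h => num_ne_of_denom hz h) ?_
    filter_upwards [ev_ne ε.denom (RatFunc.denom_ne_zero _) z,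
      ev_ne μ.denom (RatFunc.denom_ne_zero _) z] with w h1 h2 r hr h
    refine hnondis r⁻¹ (inv_pos.2 hr) w h1 h2 ?_
    rw [← hev w h1 h2, ← inv_div, h]
    push_cast
    rfl
  · intro h0
    obtain ⟨h1, h2⟩ := zero_mult ε μ hε hμ hnd₂ h0
    have := (hzero 0 h1).2
    omega
  · intro h0
    obtain ⟨h1, h2⟩ := zero_mult μ ε hμ hε hnd₁ h0
    have e : (RatFunc.X ^ 2 * μ * ε : RatFunc ℂ) = RatFunc.X ^ 2 * ε * μ := by ring
    rw [e] at h1 h2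
    have := (hzero 0 h1).2
    omega
end

section
/- Let ε₀ > 0 and let ε be a rational function with complex coefficients that is real-valued at every real point that is not a pole, satisfies ε(−conj(ω)) = conj(ε(ω)), satisfies ε(ω) → ε₀ as |ω| → ∞, and is such that ω ↦ ω ε(ω) is a Herglotz function on ℂ⁺. Then ε is of generalized Lorentz form: there exist N ∈ ℕ, real numbers ω_ℓ and positive real numbers Ω_ℓ (1 ≤ ℓ ≤ N) such that ε(ω) = ε₀ (1 + Σ_{ℓ=1}^{N} Ω_ℓ² / (ω_ℓ² − ω²)) for every ω that is not a pole. -/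
open Polynomial Complex Filter

lemma ray_lemma (f h : ℂ → ℂ) (a u : ℂ) (m : ℕ) (hu : u ≠ 0) (hcont : ContinuousAt h a)
    (hfh : ∀ᶠ z in nhdsWithin a {a}ᶜ, f z = h z / (z - a) ^ m)
    (hIm : ∀ r : ℝ, 0 < r → 0 ≤ (f (a + r * u)).im) : 0 ≤ (h a / u ^ m).im := by
  have ht : Tendsto (fun r : ℝ => a + r * u) (nhdsWithin 0 (Set.Ioi 0)) (nhdsWithin a {a}ᶜ) := by
    refine tendsto_nhdsWithin_iff.2 ⟨?_, ?_⟩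
    · have : Continuous (fun r : ℝ => a + r * u) := by fun_prop
      have := (this.tendsto 0).mono_left (nhdsWithin_le_nhds (s := Set.Ioi 0))
      simpa using this
    · filter_upwards [self_mem_nhdsWithin] with r hr
      have : (r : ℂ) ≠ 0 := by exact_mod_cast (ne_of_gt hr)
      simp [this, hu]
  have h1 : Tendsto (fun r : ℝ => (h (a + r * u) / u ^ m).im) (nhdsWithin 0 (Set.Ioi 0))
      (nhds (h a / u ^ m).im) := by
    have h2 := hcont.tendsto.comp (ht.mono_right nhdsWithin_le_nhds)
    exact (Complex.continuous_im.tendsto _).comp (h2.div_const (u ^ m))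
  refine ge_of_tendsto h1 ?_
  filter_upwards [ht.eventually hfh, self_mem_nhdsWithin] with r hr hr0
  have hr0' : 0 < r := hr0
  have hrc : (r : ℂ) ≠ 0 := by exact_mod_cast hr0'.ne'
  have h3 := hIm r hr0
  rw [hr] at h3
  have h4 : h (a + r * u) / u ^ m = ((r ^ m : ℝ) : ℂ) * (h (a + r * u) / (a + r * u - a) ^ m) := by
    push_cast
    rw [add_sub_cancel_left, mul_pow]
    field_simp
  rw [h4, Complex.im_ofReal_mul]
  positivity

lemma key_lemma (f h : ℂ → ℂ) (a : ℝ) (m : ℕ) (hm : 1 ≤ m) (hcont : ContinuousAt h a)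
    (hfh : ∀ᶠ z in nhdsWithin (a : ℂ) {(a : ℂ)}ᶜ, f z = h z / (z - a) ^ m)
    (hIm : ∀ z : ℂ, 0 < z.im → 0 ≤ (f z).im)
    (hreal : ∀ x : ℝ, (f x).im = 0) (hc : h a ≠ 0) :
    m = 1 ∧ (h a).im = 0 ∧ (h a).re < 0 := by
  have him : (h a).im = 0 := by
    have h1 := ray_lemma f h a 1 m one_ne_zero hcont hfh (fun r _ => by
      have := hreal (a + r); push_cast at this; simp [this])
    have h2 := ray_lemma (fun z => - f z) (fun z => - h z) a 1 m one_ne_zero hcont.neg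
      (hfh.mono fun z hz => by simp only [hz]; ring) (fun r _ => by
      have := hreal (a + r); push_cast at this; simp [this])
    simp at h1 h2
    linarith
  obtain ⟨c, hcc⟩ : ∃ c : ℝ, h a = c := ⟨(h a).re, by apply Complex.ext <;> simp [him]⟩
  have hray : ∀ θ : ℝ, 0 < θ → θ < Real.pi → 0 ≤ c * -Real.sin (m * θ) := by
    intro θ h0 h1
    have hs := Real.sin_pos_of_pos_of_lt_pi h0 h1
    have h2 := ray_lemma f h a (Complex.exp (θ * I)) m (Complex.exp_ne_zero _) hcont hfh
      (fun r hr => by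
        apply hIm
        simp [Complex.exp_ofReal_mul_I_im]
        positivity)
    rw [hcc, ← Complex.exp_nat_mul, div_eq_mul_inv, ← Complex.exp_neg, Complex.im_ofReal_mul] at h2
    have h3 : -((m : ℂ) * (θ * I)) = ((-(m * θ) : ℝ) : ℂ) * I := by push_cast; ring
    rw [h3, Complex.exp_ofReal_mul_I_im, Real.sin_neg] at h2
    exact h2
  have hpi := Real.pi_pos
  have hm0 : (1 : ℝ) ≤ m := by exact_mod_cast hm
  have hc0 : c ≠ 0 := by rintro rfl; simp at hcc; exact hc hcc
  have hneg : c ≤ 0 := by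
    have h1 := hray (Real.pi / 2 / m) (by positivity) (by
      rw [div_lt_iff₀ (by linarith)]; nlinarith)
    rw [mul_div_cancel₀ _ (by linarith), Real.sin_pi_div_two] at h1
    linarith
  refine ⟨?_, him, ?_⟩
  · by_contra hne
    have hm2 : (2 : ℝ) ≤ m := by exact_mod_cast (by omega : 2 ≤ m)
    have h1 := hray ((Real.pi / 2 + Real.pi) / m) (by positivity) (by
      rw [div_lt_iff₀ (by linarith)]; nlinarith)
    rw [mul_div_cancel₀ _ (by linarith), Real.sin_add_pi, Real.sin_pi_div_two] at h1
    exact hc0 (by linarith)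
  · rw [hcc]; simpa using lt_of_le_of_ne hneg hc0

lemma even_poly (p : ℂ[X]) (hp : p.comp (-X) = p) : ∃ q : ℂ[X], p = expand ℂ 2 q := by
  refine ⟨contract 2 p, ?_⟩
  ext n
  rw [coeff_expand (by norm_num)]
  split_ifs with h
  · rw [coeff_contract (by norm_num), Nat.div_mul_cancel h]
  · have h1 := congrArg (fun r => coeff r n) hp
    have hX : (-X : ℂ[X]) = C (-1) * X := by simp
    simp only [hX, comp_C_mul_X_coeff] at h1
    rw [Odd.neg_one_pow (by rw [← Nat.not_even_iff_odd, even_iff_two_dvd]; exact h)] at h1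
    linear_combination (-1/2 : ℂ) * h1

lemma even_structure (p q : ℂ[X]) (hq : q ≠ 0) (hcop : IsCoprime p q)
    (h : p.comp (-X) * q = p * q.comp (-X)) :
    ∃ P Q : ℂ[X], p = expand ℂ 2 P ∧ q = expand ℂ 2 Q := by
  have hdvd : q ∣ q.comp (-X) := hcop.symm.dvd_of_dvd_mul_left ⟨p.comp (-X), by rw [← h, mul_comm]⟩
  obtain ⟨r, hr⟩ := hdvd
  have hdeg : (q.comp (-X)).natDegree = q.natDegree := by simp [natDegree_comp]
  have hr0 : r ≠ 0 := by
    rintro rfl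
    rw [mul_zero] at hr
    have : (q.comp (-X)).comp (-X) = q := by simp [comp_assoc]
    rw [hr] at this
    exact hq (by rw [← this]; simp)
  rw [hr, natDegree_mul hq hr0] at hdeg
  obtain ⟨u, rfl⟩ : ∃ u, r = C u := ⟨_, eq_C_of_natDegree_eq_zero (by omega)⟩
  have hp : p.comp (-X) = p * C u := by
    rw [hr] at h
    exact mul_right_cancel₀ hq (by rw [h]; ring)
  have hu : u = 1 := by
    by_contra hu
    have e1 := congrArg (eval 0) hp
    have e2 := congrArg (eval 0) hr
    simp only [eval_comp, eval_neg, eval_X, neg_zero, eval_mul, eval_C] at e1 e2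
    have hu' : (1 - u) ≠ 0 := fun hh => hu (by linear_combination -hh)
    have f1 : eval 0 p = 0 := by
      apply mul_right_cancel₀ hu'; linear_combination e1
    have f2 : eval 0 q = 0 := by
      apply mul_right_cancel₀ hu'; linear_combination e2
    obtain ⟨a, b, hab⟩ := hcop
    have := congrArg (eval 0) hab
    simp [f1, f2] at this
  subst hu
  obtain ⟨P, hP⟩ := even_poly p (by simpa using hp)
  obtain ⟨Q, hQ⟩ := even_poly q (by simpa using hr)
  exact ⟨P, Q, hP, hQ⟩

lemma exists_sqrt_cases (s : ℂ) : (∃ z : ℂ, 0 < z.im ∧ z ^ 2 = s) ∨ ∃ w : ℝ, 0 ≤ w ∧ s = (w : ℂ) ^ 2 := by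
  obtain ⟨z, hz⟩ := IsAlgClosed.exists_pow_nat_eq s (n := 2) (by norm_num)
  rcases lt_trichotomy z.im 0 with h | h | h
  · left; exact ⟨-z, by simpa using h, by simpa using hz⟩
  · right
    have hz' : z = (z.re : ℂ) := by apply Complex.ext <;> simp [h]
    refine ⟨|z.re|, abs_nonneg _, ?_⟩
    rw [← hz, hz']
    norm_cast
    simp
  · left; exact ⟨z, h, hz⟩

lemma root_lemma (P Q1 : ℂ[X]) (F : ℂ → ℂ) (s0 : ℂ) (m : ℕ) (hm : 1 ≤ m)
    (hF : ∀ z, F z = eval (z ^ 2) P / ((z ^ 2 - s0) ^ m * eval (z ^ 2) Q1))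
    (hP : eval s0 P ≠ 0) (hQ : eval s0 Q1 ≠ 0) (hreal : ∀ x : ℝ, (F x).im = 0)
    (hH : DifferentiableOn ℂ (fun z => z * F z) {z : ℂ | 0 < z.im})
    (hI : ∀ z : ℂ, 0 < z.im → 0 ≤ (z * F z).im) :
    m = 1 ∧ (∃ w : ℝ, s0 = (w : ℂ) ^ 2) ∧ ∃ A : ℝ, 0 < A ∧ eval s0 P / eval s0 Q1 = ((-A : ℝ) : ℂ) := by
  have hreal' : ∀ x : ℝ, ((x : ℂ) * F x).im = 0 := fun x => by
    rw [Complex.im_ofReal_mul, hreal, mul_zero]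
  have hev : ∀ a : ℂ, a ^ 2 = s0 → ∀ᶠ z in nhds a, eval (z ^ 2) Q1 ≠ 0 := fun a ha => by
    have hc : ContinuousAt (fun z : ℂ => eval (z ^ 2) Q1) a := by fun_prop
    exact hc.eventually_ne (by simpa [ha] using hQ)
  rcases exists_sqrt_cases s0 with ⟨a, ha, has⟩ | ⟨w, hw, hws⟩
  · exfalso
    have hU : {z : ℂ | 0 < z.im} ∈ nhds a :=
      (isOpen_lt continuous_const Complex.continuous_im).mem_nhds ha
    have hc : ContinuousAt (fun z => z * F z) a := (hH.differentiableAt hU).continuousAt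
    have h1 : Tendsto (fun z : ℂ => (z ^ 2 - s0) ^ m * (z * F z) * eval (z ^ 2) Q1)
        (nhdsWithin a {a}ᶜ) (nhds 0) := by
      have hc2 : ContinuousAt (fun z : ℂ => (z ^ 2 - s0) ^ m) a := by fun_prop
      have hc3 : ContinuousAt (fun z : ℂ => eval (z ^ 2) Q1) a := by fun_prop
      have := ((hc2.mul hc).mul hc3).tendsto
      have h0 : (a ^ 2 - s0) ^ m = 0 := by rw [has, sub_self]; exact zero_pow (by omega)
      simp only [Pi.mul_apply, h0, zero_mul] at this
      exact this.mono_left nhdsWithin_le_nhds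
    have h2 : Tendsto (fun z : ℂ => z * eval (z ^ 2) P) (nhdsWithin a {a}ᶜ)
        (nhds (a * eval s0 P)) := by
      have hc3 : ContinuousAt (fun z : ℂ => z * eval (z ^ 2) P) a := by fun_prop
      have := hc3.tendsto.mono_left (nhdsWithin_le_nhds (s := {a}ᶜ))
      simpa only [has] using this
    have ha0 : a ≠ 0 := by rintro rfl; simp at ha
    have h3 : a * eval s0 P = 0 := by
      refine tendsto_nhds_unique (h2.congr' ?_) h1
      have hne : ∀ᶠ z in nhds a, z ≠ -a := by
        refine continuousAt_id.eventually_ne ?_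
        intro h
        have h : a = -a := h
        have h4 : (2 : ℂ) * a = 0 := by linear_combination h
        simp [ha0] at h4
      filter_upwards [nhdsWithin_le_nhds (hev a has), nhdsWithin_le_nhds hne,
        self_mem_nhdsWithin] with z hz1 hz2 hz3
      have h5 : z ^ 2 - s0 ≠ 0 := by
        rw [← has, sq_sub_sq]
        refine mul_ne_zero (fun h => hz2 (by linear_combination h)) (sub_ne_zero.2 hz3)
      rw [hF]
      field_simp
    exact mul_ne_zero ha0 hP h3
  · rcases hw.eq_or_lt with h0 | hpos
    · subst h0
      have hs : s0 = 0 := by simpa using hws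
      subst hs
      obtain ⟨h1, h2, h3⟩ := key_lemma (fun z => z * F z)
        (fun z => eval (z ^ 2) P / eval (z ^ 2) Q1) 0 (2 * m - 1) (by omega)
        (ContinuousAt.div (by fun_prop) (by fun_prop) (by simpa using hQ))
        (by
          filter_upwards [nhdsWithin_le_nhds (hev ((0 : ℝ) : ℂ) (by simp)), self_mem_nhdsWithin]
            with z hz1 hz2
          have hz0 : z ≠ 0 := by simpa using hz2
          obtain ⟨k, rfl⟩ : ∃ k, m = k + 1 := ⟨m - 1, by omega⟩
          rw [hF, show 2 * (k + 1) - 1 = 2 * k + 1 by omega]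
          simp only [sub_zero, Complex.ofReal_zero]
          field_simp
          ring)
        hI hreal' (by simpa using ⟨hP, hQ⟩)
      simp only [Complex.ofReal_zero, ne_eq, OfNat.ofNat_ne_zero, not_false_eq_true, zero_pow] at h2 h3
      refine ⟨by omega, ⟨0, by simp⟩, -(eval 0 P / eval 0 Q1).re, by linarith, ?_⟩
      apply Complex.ext <;> simp [h2]
    · have hwc : (w : ℂ) ≠ 0 := by exact_mod_cast hpos.ne'
      have hww : (w : ℂ) + w ≠ 0 := by rw [← two_mul]; simp [hwc]
      obtain ⟨h1, h2, h3⟩ := key_lemma (fun z => z * F z)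
        (fun z => z * eval (z ^ 2) P / (eval (z ^ 2) Q1 * (z + w) ^ m)) w m hm
        (ContinuousAt.div (by fun_prop) (by fun_prop)
          (by rw [← hws]; exact mul_ne_zero hQ (pow_ne_zero _ hww)))
        (by
          have hne : ∀ᶠ z : ℂ in nhds (w : ℂ), z + w ≠ 0 := by
            have hc : ContinuousAt (fun z : ℂ => z + w) w := by fun_prop
            exact hc.eventually_ne hww
          filter_upwards [nhdsWithin_le_nhds (hev w hws.symm), nhdsWithin_le_nhds hne,
            self_mem_nhdsWithin] with z hz1 hz2 hz3
          have hz4 : z - w ≠ 0 := sub_ne_zero.2 hz3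
          rw [hF, hws, sq_sub_sq, mul_pow]
          field_simp)
        hI hreal' (by
          rw [← hws]
          exact div_ne_zero (mul_ne_zero hwc hP) (mul_ne_zero hQ (pow_ne_zero _ hww)))
      subst h1
      have h4 : eval s0 P / eval s0 Q1 = ((2 : ℝ) : ℂ) *
          ((w : ℂ) * eval ((w : ℂ) ^ 2) P / (eval ((w : ℂ) ^ 2) Q1 * ((w : ℂ) + w) ^ 1)) := by
        rw [← hws]
        push_cast
        field_simp
        ring
      set B := ((w : ℂ) * eval ((w : ℂ) ^ 2) P / (eval ((w : ℂ) ^ 2) Q1 * ((w : ℂ) + w) ^ 1))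
      refine ⟨rfl, ⟨w, hws⟩, -(2 * B.re), by linarith, ?_⟩
      rw [h4]
      apply Complex.ext
      · simp
      · rw [Complex.im_ofReal_mul, h2]; simp

lemma main_even (P Q : ℂ[X]) (F : ℂ → ℂ) (ε₀ : ℝ) (hε₀ : 0 < ε₀) (hQm : Q.Monic)
    (hcop : ∀ s, eval s Q = 0 → eval s P ≠ 0)
    (hF : ∀ z, F z = eval (z ^ 2) P / eval (z ^ 2) Q)
    (hreal : ∀ x : ℝ, (F x).im = 0)
    (hlim : Tendsto F (Filter.comap (fun z : ℂ => ‖z‖) Filter.atTop) (nhds (ε₀ : ℂ)))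
    (hH : DifferentiableOn ℂ (fun z => z * F z) {z : ℂ | 0 < z.im})
    (hI : ∀ z : ℂ, 0 < z.im → 0 ≤ (z * F z).im) :
    ∃ (N : ℕ) (w Ω : Fin N → ℝ), (∀ ℓ, 0 < Ω ℓ) ∧
      ∀ z : ℂ, eval (z ^ 2) Q ≠ 0 →
        F z = (ε₀ : ℂ) * (1 + ∑ ℓ, ((Ω ℓ : ℂ)) ^ 2 / (((w ℓ : ℂ)) ^ 2 - z ^ 2)) := by
  classical
  have hQ0 : Q ≠ 0 := hQm.ne_zero
  have hroot : ∀ s0, eval s0 Q = 0 → ∀ (m : ℕ) (Q1 : ℂ[X]), 1 ≤ m → Q = (X - C s0) ^ m * Q1 →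
      eval s0 Q1 ≠ 0 → m = 1 ∧ (∃ w : ℝ, s0 = (w : ℂ) ^ 2) ∧
        ∃ A : ℝ, 0 < A ∧ eval s0 P / eval s0 Q1 = ((-A : ℝ) : ℂ) := by
    intro s0 hs0 m Q1 hm hQ hQ1
    refine root_lemma P Q1 F s0 m hm (fun z => ?_) (hcop _ hs0) hQ1 hreal hH hI
    rw [hF, hQ]; simp
  have hnodup : Q.roots.Nodup := by
    rw [Multiset.nodup_iff_count_le_one]
    intro s
    rw [count_roots]
    by_contra hlt
    obtain ⟨Q1, h1, h2⟩ := exists_eq_pow_rootMultiplicity_mul_and_not_dvd Q hQ0 s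
    have hs : eval s Q = 0 := (rootMultiplicity_pos hQ0).1 (by omega)
    have := (hroot s hs _ Q1 (by omega) h1 (fun h => h2 (dvd_iff_isRoot.2 h))).1
    omega
  set S := Q.roots.toFinset with hS
  have hmemS : ∀ s, s ∈ S ↔ eval s Q = 0 := fun s => by simp [hS, hQ0, IsRoot]
  have hnod : Q = Lagrange.nodal S (id : ℂ → ℂ) := by
    have h1 := (IsAlgClosed.splits Q).eq_prod_roots_of_monic hQm
    rw [Lagrange.nodal_eq, Finset.prod_eq_multiset_prod]
    simpa [hS, Multiset.toFinset_val, hnodup.dedup] using h1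
  have hA : ∀ s ∈ S, (∃ w : ℝ, s = (w : ℂ) ^ 2) ∧
      ∃ A : ℝ, 0 < A ∧ Lagrange.nodalWeight S (id : ℂ → ℂ) s * eval s P = ((-A : ℝ) : ℂ) := by
    intro s hs
    have h1 : Q = (X - C s) ^ 1 * Lagrange.nodal (S.erase s) (id : ℂ → ℂ) := by
      rw [pow_one]
      conv_lhs => rw [hnod, Lagrange.nodal_eq, ← Finset.mul_prod_erase S _ hs]
      rfl
    have h2 : eval s (Lagrange.nodal (S.erase s) (id : ℂ → ℂ)) ≠ 0 := by
      rw [Lagrange.eval_nodal, Finset.prod_ne_zero_iff]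
      intro i hi
      exact sub_ne_zero.2 (Finset.ne_of_mem_erase hi).symm
    obtain ⟨-, h3, A, hA, h4⟩ := hroot s ((hmemS s).1 hs) 1 _ le_rfl h1 h2
    refine ⟨h3, A, hA, ?_⟩
    rw [Lagrange.nodalWeight_eq_eval_nodal_erase_inv, ← h4, div_eq_mul_inv, mul_comm]
    rfl
  choose! w hw using fun s hs => (hA s hs).1
  choose! A hApos hAeq using fun s hs => (hA s hs).2
  -- division with remainder
  have hdiv := modByMonic_add_div P Q
  have hT : P %ₘ Q = Lagrange.interpolate S (id : ℂ → ℂ) (fun s => eval s P) := by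
    apply Lagrange.eq_interpolate_of_eval_eq _ Function.injective_id.injOn
    · have h1 := degree_modByMonic_lt P hQm
      rwa [hnod, Lagrange.degree_nodal, ← hnod] at h1
    · intro s hs
      have h1 := congrArg (eval s) hdiv
      simpa [(hmemS s).1 hs] using h1
  have hform : ∀ z, eval (z ^ 2) Q ≠ 0 →
      F z = eval (z ^ 2) (P /ₘ Q) + ∑ s ∈ S, (A s : ℂ) / ((w s : ℂ) ^ 2 - z ^ 2) := by
    intro z hz
    have h1 := congrArg (eval (z ^ 2)) hdiv
    have h2 : eval (z ^ 2) (P %ₘ Q) = eval (z ^ 2) Q *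
        ∑ s ∈ S, (A s : ℂ) / ((w s : ℂ) ^ 2 - z ^ 2) := by
      rw [hT, Lagrange.eval_interpolate_not_at_node _ (fun s hs h => hz (by
        rw [h]; exact (hmemS s).1 hs)), ← hnod]
      congr 1
      refine Finset.sum_congr rfl fun s hs => ?_
      rw [mul_right_comm, hAeq s hs, ← hw s hs, ← neg_sub (z ^ 2) s, div_neg, div_eq_mul_inv]
      push_cast
      simp only [id, neg_mul]
    rw [eval_add, eval_mul, h2] at h1
    rw [hF, ← h1]
    field_simp
    ring
  have hcomap : Tendsto (fun z : ℂ => ‖z ^ 2‖) (Filter.comap (fun z : ℂ => ‖z‖) Filter.atTop) atTop := by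
    simp only [norm_pow]
    exact (tendsto_pow_atTop (by norm_num)).comp tendsto_comap
  have hsum : Tendsto (fun z : ℂ => ∑ s ∈ S, (A s : ℂ) / ((w s : ℂ) ^ 2 - z ^ 2))
      (Filter.comap (fun z : ℂ => ‖z‖) Filter.atTop) (nhds 0) := by
    rw [← Finset.sum_const_zero (s := S) (ι := ℂ)]
    refine tendsto_finset_sum _ fun s _ => ?_
    have h1 : Tendsto (fun z : ℂ => ‖eval (z ^ 2) (C ((w s : ℂ) ^ 2) - X)‖)
        (Filter.comap (fun z : ℂ => ‖z‖) Filter.atTop) atTop := by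
      refine tendsto_norm_atTop _ ?_ hcomap
      rw [← neg_sub, degree_neg, degree_X_sub_C]
      norm_num
    have h2 := tendsto_inv₀_cobounded.comp (tendsto_norm_atTop_iff_cobounded.1 h1)
    have h3 := h2.const_mul (A s : ℂ)
    simpa [div_eq_mul_inv, Function.comp_def] using h3
  have hevQ : ∀ᶠ z in Filter.comap (fun z : ℂ => ‖z‖) Filter.atTop, eval (z ^ 2) Q ≠ 0 := by
    have h1 : ∀ᶠ z in Filter.comap (fun z : ℂ => ‖z‖) Filter.atTop, ∀ s ∈ S, ‖s‖ < ‖z ^ 2‖ :=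
      (Filter.eventually_all_finset S).2 fun s _ => hcomap.eventually_gt_atTop ‖s‖
    filter_upwards [h1] with z hz h
    exact lt_irrefl _ (hz _ ((hmemS _).2 h))
  have hpoly : Tendsto (fun z : ℂ => eval (z ^ 2) (P /ₘ Q))
      (Filter.comap (fun z : ℂ => ‖z‖) Filter.atTop) (nhds (ε₀ : ℂ)) := by
    have h1 := hlim.sub hsum
    rw [sub_zero] at h1
    refine h1.congr' ?_
    filter_upwards [hevQ] with z hz
    rw [hform z hz]; ring
  haveI hne : (Filter.comap (fun z : ℂ => ‖z‖) Filter.atTop).NeBot := by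
    rw [comap_norm_atTop]; infer_instance
  have hconst : ∃ c, P /ₘ Q = C c := by
    by_contra hcon
    have hdeg : 0 < degree (P /ₘ Q) := by
      by_contra hd
      exact hcon ⟨_, eq_C_of_degree_le_zero (not_lt.1 hd)⟩
    exact not_tendsto_atTop_of_tendsto_nhds hpoly.norm (tendsto_norm_atTop _ hdeg hcomap)
  obtain ⟨c, hc⟩ := hconst
  have hcε : c = ε₀ := by
    rw [hc] at hpoly
    simp only [eval_C] at hpoly
    exact tendsto_nhds_unique tendsto_const_nhds hpoly
  refine ⟨S.card, fun l => w (S.equivFin.symm l), fun l => Real.sqrt (A (S.equivFin.symm l) / ε₀),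
    fun l => Real.sqrt_pos.2 (div_pos (hApos _ (S.equivFin.symm l).2) hε₀), fun z hz => ?_⟩
  have hεc : (ε₀ : ℂ) ≠ 0 := by exact_mod_cast hε₀.ne'
  rw [hform z hz, hc, eval_C, hcε, mul_add, mul_one, Finset.mul_sum]
  congr 1
  rw [← Finset.sum_coe_sort S, ← S.equivFin.symm.sum_comp]
  refine Finset.sum_congr rfl fun l _ => ?_
  rw [← Complex.ofReal_pow (Real.sqrt _), Real.sq_sqrt (div_pos (hApos _ (S.equivFin.symm l).2) hε₀).le]
  push_cast
  field_simp

/-- Representation of local lossless passive materials: if `ε` is rational, real-valued on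
the real axis outside its poles, satisfies the reality principle, tends to `ε₀ > 0` at
infinity and `ω ε(ω)` is Herglotz, then `ε` is a generalized Lorentz permittivity:
`ε(ω) = ε₀ (1 + Σ_ℓ Ω_ℓ² / (ω_ℓ² - ω²))` with `ω_ℓ` real and `Ω_ℓ > 0`. -/
theorem lossless_passive_is_generalized_lorentz (ε : RatFunc ℂ) (ε₀ : ℝ) (hε₀ : 0 < ε₀)
    (hεloss : ∀ x : ℝ, Polynomial.eval (x : ℂ) ε.denom ≠ 0 →
      (RatFunc.eval (RingHom.id ℂ) (x : ℂ) ε).im = 0)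
    (hεreal : ∀ z : ℂ, Polynomial.eval z ε.denom ≠ 0 →
      RatFunc.eval (RingHom.id ℂ) (-(starRingEnd ℂ z)) ε
        = starRingEnd ℂ (RatFunc.eval (RingHom.id ℂ) z ε))
    (hεlim : Tendsto (fun z : ℂ => RatFunc.eval (RingHom.id ℂ) z ε)
      (Filter.comap (fun z : ℂ => ‖z‖) Filter.atTop) (nhds (ε₀ : ℂ)))
    (hεH : IsHerglotz (fun z : ℂ => z * RatFunc.eval (RingHom.id ℂ) z ε)) :
    ∃ (N : ℕ) (w Ω : Fin N → ℝ), (∀ ℓ, 0 < Ω ℓ) ∧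
      ∀ z : ℂ, Polynomial.eval z ε.denom ≠ 0 →
        RatFunc.eval (RingHom.id ℂ) z ε
          = (ε₀ : ℂ) * (1 + ∑ ℓ, ((Ω ℓ : ℂ)) ^ 2 / (((w ℓ : ℂ)) ^ 2 - z ^ 2)) := by
  have hev : ∀ z, RatFunc.eval (RingHom.id ℂ) z ε = eval z ε.num / eval z ε.denom := fun z => rfl
  have hq0 : ε.denom ≠ 0 := ε.denom_ne_zero
  have hreal : ∀ x : ℝ, (RatFunc.eval (RingHom.id ℂ) (x : ℂ) ε).im = 0 := by
    intro x
    by_cases h : eval (x : ℂ) ε.denom = 0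
    · rw [hev, h]; simp
    · exact hεloss x h
  have hcopP := ε.isCoprime_num_denom
  have hcomp : ε.num.comp (-X) * ε.denom = ε.num * ε.denom.comp (-X) := by
    have hz : (ε.num.comp (-X) * ε.denom - ε.num * ε.denom.comp (-X)) *
        (ε.denom * ε.denom.comp (-X)) = 0 := by
      refine eq_zero_of_infinite_isRoot _ (Set.Infinite.mono ?_
        (Set.infinite_range_of_injective Complex.ofReal_injective))
      rintro _ ⟨x, rfl⟩
      simp only [Set.mem_setOf_eq, IsRoot, eval_mul, eval_sub, eval_comp, eval_neg, eval_X]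
      by_cases h1 : eval (x : ℂ) ε.denom = 0
      · simp [h1]
      by_cases h2 : eval (-(x : ℂ)) ε.denom = 0
      · simp [h2]
      have h3 := hεreal x h1
      rw [Complex.conj_eq_iff_im.2 (hreal x), Complex.conj_ofReal, hev, hev,
        div_eq_div_iff h2 h1] at h3
      rw [h3]; ring
    have hne : ε.denom * ε.denom.comp (-X) ≠ 0 :=
      mul_ne_zero hq0 (by rwa [Ne, comp_neg_X_eq_zero_iff])
    exact sub_eq_zero.1 ((mul_eq_zero.1 hz).resolve_right hne)
  obtain ⟨P, Q, hP, hQ⟩ := even_structure _ _ hq0 hcopP hcomp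
  have hPe : ∀ z, eval z ε.num = eval (z ^ 2) P := fun z => by rw [hP, expand_eval]
  have hQe : ∀ z, eval z ε.denom = eval (z ^ 2) Q := fun z => by rw [hQ, expand_eval]
  have hQm : Q.Monic := by
    rw [← monic_expand_iff (p := 2) (by norm_num), ← hQ]
    exact ε.monic_denom
  obtain ⟨N, w, Ω, h1, h2⟩ := main_even P Q (fun z => RatFunc.eval (RingHom.id ℂ) z ε) ε₀ hε₀ hQm
    (fun s hs hsP => by
      obtain ⟨z, rfl⟩ := IsAlgClosed.exists_pow_nat_eq s (n := 2) (by norm_num)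
      obtain ⟨a, b, hab⟩ := hcopP
      have := congrArg (eval z) hab
      simp [hPe, hQe, hs, hsP] at this)
    (fun z => by rw [hev, hPe, hQe]) hreal hεlim hεH.1 hεH.2
  exact ⟨N, w, Ω, h1, fun z hz => h2 z (by rwa [← hQe])⟩
end

section
/- Let ε₀ > 0, N ∈ ℕ, ω_ℓ ∈ ℝ and Ω_ℓ > 0 for 1 ≤ ℓ ≤ N, and define the generalized Lorentz permittivity ε(ω) = ε₀ (1 + Σ_{ℓ=1}^{N} Ω_ℓ²/(ω_ℓ² − ω²)). Then for every ω ∈ ℂ⁺ one has Im(ω ε(ω)) = ε₀ · (Im ω) · (1 + Σ_{ℓ=1}^{N} Ω_ℓ² (ω_ℓ² + |ω|²)/|ω_ℓ² − ω²|²) > 0; in particular ω ↦ ω ε(ω) is a Herglotz function, so generalized Lorentz materials are passive. -/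
open Complex

theorem lorentz_term_im (a b : ℝ) (ω : ℂ) :
    (ω * ((a : ℂ) ^ 2 / ((b : ℂ) ^ 2 - ω ^ 2))).im
      = ω.im * (a ^ 2 * (b ^ 2 + ‖ω‖ ^ 2) / ‖(b : ℂ) ^ 2 - ω ^ 2‖ ^ 2) := by
  have h : ω * ((a : ℂ) ^ 2 / ((b : ℂ) ^ 2 - ω ^ 2))
      = ((a ^ 2 / Complex.normSq ((b : ℂ) ^ 2 - ω ^ 2) : ℝ) : ℂ)
        * (ω * (starRingEnd ℂ) ((b : ℂ) ^ 2 - ω ^ 2)) := by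
    rw [div_eq_mul_inv, Complex.inv_def]
    push_cast
    ring
  have h2 : (ω * (starRingEnd ℂ) ((b : ℂ) ^ 2 - ω ^ 2)).im
      = ω.im * (b ^ 2 + Complex.normSq ω) := by
    simp [Complex.normSq_apply, pow_two]
    ring
  rw [h, Complex.im_ofReal_mul, h2, Complex.sq_norm, Complex.sq_norm]
  ring

theorem lorentz_denom_ne (b : ℝ) (ω : ℂ) (h : 0 < ω.im) : (b : ℂ) ^ 2 - ω ^ 2 ≠ 0 := by
  intro h0
  have h1 : ((b : ℂ) - ω) * ((b : ℂ) + ω) = 0 := by rw [← h0]; ring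
  rcases mul_eq_zero.mp h1 with h2 | h2
  · have := congrArg Complex.im h2
    simp at this
    linarith
  · have := congrArg Complex.im h2
    simp at this
    linarith

/-- Generalized Lorentz materials are passive: for the generalized Lorentz permittivity
`ε(ω) = ε₀ (1 + Σ_ℓ Ω_ℓ²/(ω_ℓ² - ω²))` with `ε₀ > 0`, `ω_ℓ ∈ ℝ`, `Ω_ℓ > 0`, one has, for
every `ω ∈ ℂ⁺`,
`Im (ω ε(ω)) = ε₀ (Im ω) (1 + Σ_ℓ Ω_ℓ² (ω_ℓ² + |ω|²)/|ω_ℓ² - ω²|²) > 0`;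
in particular `ω ↦ ω ε(ω)` is a Herglotz function. -/
theorem generalized_lorentz_is_passive (ε₀ : ℝ) (hε₀ : 0 < ε₀) (N : ℕ)
    (w Ω : Fin N → ℝ) (hΩ : ∀ ℓ, 0 < Ω ℓ) :
    (∀ ω : ℂ, 0 < ω.im →
      (ω * ((ε₀ : ℂ) * (1 + ∑ ℓ, ((Ω ℓ : ℂ)) ^ 2 / (((w ℓ : ℂ)) ^ 2 - ω ^ 2)))).im
        = ε₀ * ω.im *
            (1 + ∑ ℓ, (Ω ℓ) ^ 2 * ((w ℓ) ^ 2 + ‖ω‖ ^ 2) /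
              ‖((w ℓ : ℂ)) ^ 2 - ω ^ 2‖ ^ 2) ∧
      0 < (ω * ((ε₀ : ℂ) * (1 + ∑ ℓ, ((Ω ℓ : ℂ)) ^ 2 / (((w ℓ : ℂ)) ^ 2 - ω ^ 2)))).im) ∧
    IsHerglotz (fun ω : ℂ =>
      ω * ((ε₀ : ℂ) * (1 + ∑ ℓ, ((Ω ℓ : ℂ)) ^ 2 / (((w ℓ : ℂ)) ^ 2 - ω ^ 2)))) := by
  have key : ∀ ω : ℂ, 0 < ω.im →
      (ω * ((ε₀ : ℂ) * (1 + ∑ ℓ, ((Ω ℓ : ℂ)) ^ 2 / (((w ℓ : ℂ)) ^ 2 - ω ^ 2)))).im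
        = ε₀ * ω.im *
            (1 + ∑ ℓ, (Ω ℓ) ^ 2 * ((w ℓ) ^ 2 + ‖ω‖ ^ 2) /
              ‖((w ℓ : ℂ)) ^ 2 - ω ^ 2‖ ^ 2) ∧
      0 < (ω * ((ε₀ : ℂ) * (1 + ∑ ℓ, ((Ω ℓ : ℂ)) ^ 2 / (((w ℓ : ℂ)) ^ 2 - ω ^ 2)))).im := by
    intro ω hω
    have e : (ω * ((ε₀ : ℂ) * (1 + ∑ ℓ, ((Ω ℓ : ℂ)) ^ 2 / (((w ℓ : ℂ)) ^ 2 - ω ^ 2)))).im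
        = ε₀ * ω.im *
            (1 + ∑ ℓ, (Ω ℓ) ^ 2 * ((w ℓ) ^ 2 + ‖ω‖ ^ 2) /
              ‖((w ℓ : ℂ)) ^ 2 - ω ^ 2‖ ^ 2) := by
      rw [mul_left_comm, Complex.im_ofReal_mul, mul_add, mul_one, Finset.mul_sum,
        Complex.add_im, Complex.im_sum, mul_assoc, mul_add ω.im, mul_one, Finset.mul_sum]
      simp only [lorentz_term_im]
    refine ⟨e, ?_⟩
    rw [e]
    have : 0 ≤ ∑ ℓ, (Ω ℓ) ^ 2 * ((w ℓ) ^ 2 + ‖ω‖ ^ 2) / ‖((w ℓ : ℂ)) ^ 2 - ω ^ 2‖ ^ 2 :=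
      Finset.sum_nonneg fun ℓ _ => by positivity
    positivity
  refine ⟨key, ?_, fun z hz => (key z hz).2.le⟩
  intro z hz
  apply DifferentiableAt.differentiableWithinAt
  refine differentiableAt_id.mul ((differentiableAt_const _).mul
    ((differentiableAt_const _).add (DifferentiableAt.fun_sum fun ℓ _ => ?_)))
  exact (differentiableAt_const _).div (by fun_prop) (lorentz_denom_ne (w ℓ) z hz)
end

section
/- Let ε and μ be rational functions with complex coefficients such that ε(ω) → ε₀ > 0 and μ(ω) → μ₀ > 0 as |ω| → ∞, satisfying the reality principle ε(−conj(ω)) = conj(ε(ω)) and μ(−conj(ω)) = conj(μ(ω)), non-degenerate (no pole of ε is a zero of ω μ(ω) and no pole of μ is a zero of ω ε(ω)), and non-dissipative: for every real r > 0, every complex solution ω of ω² ε(ω) μ(ω) = r is real. Then the medium is equivalent to a passive (generalized Lorentz) medium: there exist rational functions ε* and μ*, each of generalized Lorentz form ε*(ω) = ε₀*(1 + Σ_ℓ a_ℓ/(ω_ℓ² − ω²)) with positive coefficients a_ℓ and real ω_ℓ (and similarly for μ*), such that ε*(ω) μ*(ω) = ε(ω) μ(ω) as rational functions; in particular ω ε*(ω)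 and ω μ*(ω) are Herglotz functions. -/
open Polynomial Complex Filter

/-- `f` is of generalized Lorentz form with static constant `c > 0`:
`f(ω) = c (1 + Σ_ℓ a_ℓ/(ω_ℓ² - ω²))` with `ω_ℓ` real and `a_ℓ > 0`. -/
def IsGeneralizedLorentz (f : RatFunc ℂ) (c : ℝ) : Prop :=
  0 < c ∧ ∃ (N : ℕ) (w a : Fin N → ℝ), (∀ ℓ, 0 < a ℓ) ∧
    ∀ z : ℂ, Polynomial.eval z f.denom ≠ 0 →
      RatFunc.eval (RingHom.id ℂ) z f
        = (c : ℂ) * (1 + ∑ ℓ, ((a ℓ : ℂ)) / (((w ℓ : ℂ)) ^ 2 - z ^ 2))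


lemma partial_fraction {ι : Type*} [LinearOrder ι] (S : Finset ι) (x p : ι → ℝ)
    (h1 : ∀ i ∈ S, p i < x i) (h2 : ∀ i ∈ S, ∀ j ∈ S, i < j → x j < p i) :
    ∃ a : ι → ℝ, (∀ i ∈ S, 0 < a i) ∧ ∀ t : ℂ, (∀ i ∈ S, t ≠ (p i : ℂ)) →
      ∏ i ∈ S, (t - (x i : ℂ)) =
        (∏ i ∈ S, (t - (p i : ℂ))) * (1 + ∑ i ∈ S, (a i : ℂ) / ((p i : ℂ) - t)) := by
  have hanti : ∀ i ∈ S, ∀ j ∈ S, i < j → p j < p i := fun i hi j hj hij =>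
    (h1 j hj).trans (h2 i hi j hj hij)
  have hne : ∀ i ∈ S, ∀ j ∈ S, i ≠ j → p i ≠ p j := by
    intro i hi j hj hij
    rcases lt_or_gt_of_ne hij with h | h
    · exact (hanti i hi j hj h).ne'
    · exact (hanti j hj i hi h).ne
  refine ⟨fun i => (x i - p i) * ∏ j ∈ S.erase i, (p i - x j) * (p i - p j)⁻¹, ?_, ?_⟩
  · intro i hi
    refine mul_pos (sub_pos.2 (h1 i hi)) (Finset.prod_pos ?_)
    intro j hj
    rw [Finset.mem_erase] at hj
    rcases lt_or_gt_of_ne hj.1 with h | h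
    · have e1 := hanti j hj.2 i hi h
      have e2 := h1 j hj.2
      exact mul_pos_of_neg_of_neg (by linarith) (inv_lt_zero.2 (by linarith))
    · have e1 := hanti i hi j hj.2 h
      have e2 := h2 i hi j hj.2 h
      exact mul_pos (by linarith) (inv_pos.2 (by linarith))
  · intro t ht
    have hinj : Set.InjOn (fun i => (p i : ℂ)) S := by
      intro i hi j hj hij
      by_contra hne'
      exact hne i hi j hj hne' (Complex.ofReal_injective hij)
    set f : ℂ[X] := Lagrange.nodal S (fun i => (x i : ℂ)) - Lagrange.nodal S (fun i => (p i : ℂ))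
      with hf
    have hdeg : f.degree < S.card := by
      have := Polynomial.degree_sub_lt_left (p := Lagrange.nodal S (fun i => (x i : ℂ)))
        (q := Lagrange.nodal S (fun i => (p i : ℂ)))
        (by rw [Lagrange.degree_nodal, Lagrange.degree_nodal]) Lagrange.nodal_ne_zero
        (by rw [(Lagrange.nodal_monic).leadingCoeff, (Lagrange.nodal_monic).leadingCoeff])
      rwa [Lagrange.degree_nodal] at this
    have e1 := Lagrange.eq_interpolate hinj hdeg
    have e2 := congrArg (Polynomial.eval t) e1
    rw [Lagrange.eval_interpolate_not_at_node _ ht] at e2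
    rw [hf, Polynomial.eval_sub, Lagrange.eval_nodal, Lagrange.eval_nodal] at e2
    rw [sub_eq_iff_eq_add] at e2
    rw [e2, mul_add, mul_one, add_comm]
    congr 2
    refine Finset.sum_congr rfl fun i hi => ?_
    rw [Polynomial.eval_sub, Lagrange.eval_nodal_at_node (v := fun i => (p i : ℂ)) hi, Lagrange.eval_nodal, sub_zero,
      Lagrange.nodalWeight, ← Finset.mul_prod_erase S _ hi]
    simp only [Finset.prod_mul_distrib]
    push_cast
    rw [← neg_sub t, div_neg, div_eq_mul_inv]
    ring

lemma lorentz_aux {ι : Type*} [LinearOrder ι] (S : Finset ι) (x p : ι → ℝ)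
    (hp : ∀ i ∈ S, 0 ≤ p i)
    (h1 : ∀ i ∈ S, p i < x i) (h2 : ∀ i ∈ S, ∀ j ∈ S, i < j → x j < p i) (c : ℝ) (hc : 0 < c)
    (A B : ℂ[X]) (hA : A = C (c : ℂ) * ∏ i ∈ S, (X ^ 2 - C ((x i : ℂ) ^ 2)))
    (hB : B = ∏ i ∈ S, (X ^ 2 - C ((p i : ℂ) ^ 2))) (f : RatFunc ℂ)
    (hf : f = algebraMap ℂ[X] (RatFunc ℂ) A / algebraMap ℂ[X] (RatFunc ℂ) B) :
    IsGeneralizedLorentz f c ∧ IsHerglotz (fun z : ℂ => z * RatFunc.eval (RingHom.id ℂ) z f) := by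
  obtain ⟨a, ha, hpf⟩ := partial_fraction S (fun i => x i ^ 2) (fun i => p i ^ 2)
    (fun i hi => by have := hp i hi; have := h1 i hi; nlinarith)
    (fun i hi j hj hij => by
      have := hp i hi; have := h2 i hi j hj hij; have := h1 j hj; have := hp j hj
      nlinarith)
  have hB0 : B ≠ 0 := by
    rw [hB]
    refine Finset.prod_ne_zero_iff.2 fun i _ => ?_
    exact Polynomial.X_pow_sub_C_ne_zero (by norm_num) _
  have hmul : f.num * B = A * f.denom := (RatFunc.num_mul_eq_mul_denom_iff hB0).2 hf
  have hanti : ∀ i ∈ S, ∀ j ∈ S, i < j → p j < p i := fun i hi j hj hij =>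
    (h1 j hj).trans (h2 i hi j hj hij)
  have hAe : ∀ z : ℂ, A.eval z = c * ∏ i ∈ S, (z ^ 2 - (x i : ℂ) ^ 2) := by
    intro z; rw [hA]; simp [Polynomial.eval_prod]
  have hBe : ∀ z : ℂ, B.eval z = ∏ i ∈ S, (z ^ 2 - (p i : ℂ) ^ 2) := by
    intro z; rw [hB]; simp [Polynomial.eval_prod]
  -- no common zeros
  have hcop : ∀ z : ℂ, B.eval z = 0 → A.eval z ≠ 0 := by
    intro z hz hz'
    rw [hBe, Finset.prod_eq_zero_iff] at hz
    rw [hAe, mul_eq_zero, Finset.prod_eq_zero_iff] at hz'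
    obtain ⟨i, hi, hi'⟩ := hz
    rcases hz' with hz' | ⟨j, hj, hj'⟩
    · exact hc.ne' (by exact_mod_cast hz')
    have e : (p i : ℂ) ^ 2 = (x j : ℂ) ^ 2 := by
      rw [sub_eq_zero] at hi' hj'; rw [← hi', hj']
    have e' : p i ^ 2 = x j ^ 2 := by exact_mod_cast e
    have hpi := hp i hi
    have hpj := hp j hj
    have hxj := h1 j hj
    have e'' : p i = x j := by
      have := abs_eq_abs.2 (sq_eq_sq_iff_eq_or_eq_neg.1 e')
      rwa [abs_of_nonneg hpi, abs_of_nonneg (by linarith)] at this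
    rcases lt_trichotomy i j with h | h | h
    · exact (h2 i hi j hj h).ne' e''
    · subst h; linarith
    · have := hanti j hj i hi h; linarith
  have hden : ∀ z : ℂ, f.denom.eval z ≠ 0 → B.eval z ≠ 0 := by
    intro z hz hz'
    have := congrArg (Polynomial.eval z) hmul
    rw [Polynomial.eval_mul, Polynomial.eval_mul, hz', mul_zero] at this
    exact (mul_ne_zero (hcop z hz') hz) this.symm
  have hden' : ∀ z : ℂ, B.eval z ≠ 0 → f.denom.eval z ≠ 0 := by
    intro z hz hz'
    have : f.denom ∣ B := by rw [hf]; exact RatFunc.denom_div_dvd _ _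
    exact hz (Polynomial.eval_eq_zero_of_dvd_of_eval_eq_zero this hz')
  have hform : ∀ z : ℂ, f.denom.eval z ≠ 0 → RatFunc.eval (RingHom.id ℂ) z f
        = (c : ℂ) * (1 + ∑ i ∈ S, ((a i : ℂ)) / (((p i : ℂ)) ^ 2 - z ^ 2)) := by
    intro z hz
    have hz' := hden z hz
    have key := congrArg (Polynomial.eval z) hmul
    rw [Polynomial.eval_mul, Polynomial.eval_mul] at key
    have hne : ∀ i ∈ S, z ^ 2 ≠ ((p i ^ 2 : ℝ) : ℂ) := by
      intro i hi h
      apply hz'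
      rw [hBe]
      exact Finset.prod_eq_zero hi (by rw [h]; push_cast; ring)
    have h := hpf (z ^ 2) hne
    push_cast at h
    rw [RatFunc.eval, ← Polynomial.eval, ← Polynomial.eval, div_eq_iff hz]
    apply mul_right_cancel₀ hz'
    rw [key, hAe, h, hBe]
    ring
  refine ⟨⟨hc, S.card, fun ℓ => p (S.equivFin.symm ℓ), fun ℓ => a (S.equivFin.symm ℓ),
    fun ℓ => ha _ (S.equivFin.symm ℓ).2, ?_⟩, ?_, ?_⟩
  · intro z hz
    rw [hform z hz]
    congr 2
    rw [Equiv.sum_comp S.equivFin.symm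
      (fun i : S => ((a i : ℂ)) / (((p i : ℂ)) ^ 2 - z ^ 2))]
    exact (Finset.sum_coe_sort S (fun i => ((a i : ℂ)) / (((p i : ℂ)) ^ 2 - z ^ 2))).symm
  all_goals
    have hnr : ∀ z : ℂ, 0 < z.im → f.denom.eval z ≠ 0 := by
      intro z hz
      apply hden'
      rw [hBe, Finset.prod_ne_zero_iff]
      intro i _ h
      have : (z - (p i : ℂ)) * (z + (p i : ℂ)) = 0 := by rw [← h]; ring
      rcases mul_eq_zero.1 this with h' | h'
      · have := congrArg Complex.im h'; simp at this; linarith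
      · have := congrArg Complex.im h'; simp at this; linarith
  · intro z hz
    apply DifferentiableAt.differentiableWithinAt
    unfold RatFunc.eval
    refine differentiableAt_id.mul (DifferentiableAt.div ?_ ?_ ?_)
    · exact Polynomial.differentiableAt (f.num)
    · exact Polynomial.differentiableAt (f.denom)
    · exact hnr z hz
  · intro z hz
    simp only
    rw [hform z (hnr z hz)]
    have : z * ((c : ℂ) * (1 + ∑ i ∈ S, ((a i : ℂ)) / (((p i : ℂ)) ^ 2 - z ^ 2)))
      = (c : ℂ) * (z + ∑ i ∈ S, (a i : ℂ) * (z / (((p i : ℂ)) ^ 2 - z ^ 2))) := by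
      rw [mul_left_comm, mul_add, mul_one, Finset.mul_sum]
      congr 2
      refine Finset.sum_congr rfl fun i _ => ?_
      ring
    rw [this, Complex.im_ofReal_mul]
    refine mul_nonneg hc.le ?_
    rw [Complex.add_im, Complex.im_sum]
    refine add_nonneg hz.le (Finset.sum_nonneg fun i hi => ?_)
    rw [Complex.im_ofReal_mul]
    refine mul_nonneg (ha i hi).le ?_
    rw [Complex.div_im, div_sub_div_same]
    refine div_nonneg ?_ (Complex.normSq_nonneg _)
    have e : z.im * ((p i : ℂ) ^ 2 - z ^ 2).re - z.re * ((p i : ℂ) ^ 2 - z ^ 2).im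
        = z.im * (p i ^ 2 + z.re ^ 2 + z.im ^ 2) := by
      simp [pow_two]; ring
    rw [e]
    positivity

lemma exists_antitone_enum (A : Multiset ℝ) (s : ℕ) (h : A.card = s) :
    ∃ x : Fin s → ℝ, Antitone x ∧ Finset.univ.val.map x = A := by
  subst h
  obtain ⟨L, hL⟩ : ∃ L : List ℝ, L = A.sort (· ≥ ·) := ⟨_, rfl⟩
  have hLA : (L : Multiset ℝ) = A := by rw [hL]; exact Multiset.sort_eq _ _
  have hs : L.Pairwise (· ≥ ·) := by rw [hL]; exact Multiset.pairwise_sort _ _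
  clear hL
  subst hLA
  refine ⟨fun i => L.get i, ?_, ?_⟩
  · intro i j hij
    rcases hij.lt_or_eq with h | h
    · exact List.pairwise_iff_get.1 hs i j h
    · rw [h]
  · have : (Finset.univ : Finset (Fin L.length)).val = (List.finRange L.length : Multiset _) := rfl
    change Multiset.map L.get (Finset.univ : Finset (Fin L.length)).val = _
    rw [this, Multiset.map_coe, List.map_get_finRange]

lemma exists_between_notMem (A : Multiset ℝ) {u v : ℝ} (h : u < v) :
    ∃ y, u < y ∧ y < v ∧ y ∉ A := by
  have : (Set.Ioo u v \ (A.toFinset : Set ℝ)).Nonempty :=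
    ((Set.Ioo_infinite h).sdiff A.toFinset.finite_toSet).nonempty
  obtain ⟨y, hy, hy'⟩ := this
  exact ⟨y, hy.1, hy.2, by simpa using hy'⟩

lemma le_card_filter {s : ℕ} (x : Fin s → ℝ) (hx : Antitone x) (y : ℝ) (j : Fin s) (h : y < x j) :
    (j : ℕ) + 1 ≤ ((Finset.univ.val.map x).filter (y < ·)).card := by
  rw [Multiset.filter_map, Multiset.card_map]
  calc (j : ℕ) + 1 = (Finset.Iic j).card := by simp
    _ ≤ (Finset.univ.filter (fun i => y < x i)).card := by
      apply Finset.card_le_card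
      intro i hi
      simp only [Finset.mem_Iic] at hi
      simp only [Finset.mem_filter, Finset.mem_univ, true_and]
      exact h.trans_le (hx hi)

lemma card_filter_le {s : ℕ} (x : Fin s → ℝ) (hx : Antitone x) (y : ℝ) (j : Fin s) (h : x j < y) :
    ((Finset.univ.val.map x).filter (y < ·)).card ≤ (j : ℕ) := by
  rw [Multiset.filter_map, Multiset.card_map]
  calc _ = (Finset.univ.filter (fun i => y < x i)).card := rfl
    _ ≤ (Finset.Iio j).card := by
      apply Finset.card_le_card
      intro i hi
      simp only [Finset.mem_filter, Finset.mem_univ, true_and] at hi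
      simp only [Finset.mem_Iio]
      by_contra hc
      have := hx (not_lt.1 hc)
      linarith
    _ = j := by simp

lemma interlace (A B : Multiset ℝ) (s : ℕ) (hA : A.card = s) (hB : B.card = s)
    (hApos : ∀ a ∈ A, 0 < a) (hBpos : ∀ b ∈ B, 0 ≤ b) (hdis : ∀ a ∈ A, a ∉ B)
    (hc : ∀ y, 0 < y → y ∉ A → y ∉ B → (B.filter (y < ·)).card ≤ (A.filter (y < ·)).card ∧
      (A.filter (y < ·)).card ≤ (B.filter (y < ·)).card + 2) :
    ∃ x p : Fin s → ℝ, Antitone x ∧ Finset.univ.val.map x = A ∧ Finset.univ.val.map p = B ∧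
      (∀ i, 0 ≤ p i) ∧ (∀ i, p i < x i) ∧ (∀ i j : Fin s, (i : ℕ) + 2 ≤ j → x j < p i) := by
  obtain ⟨x, hx, rfl⟩ := exists_antitone_enum A s hA
  obtain ⟨p, hp, rfl⟩ := exists_antitone_enum B s hB
  have hxm : ∀ i, x i ∈ Finset.univ.val.map x := fun i => by simp
  have hpm : ∀ i, p i ∈ Finset.univ.val.map p := fun i => by simp
  have hne : ∀ i j, x i ≠ p j := fun i j h => hdis _ (hxm i) (h ▸ hpm j)
  refine ⟨x, p, hx, rfl, rfl, fun i => hBpos _ (hpm i), ?_, ?_⟩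
  · intro i
    by_contra hcon
    have hlt : x i < p i := lt_of_le_of_ne (not_lt.1 hcon) (hne i i)
    obtain ⟨y, h1, h2, h3⟩ := exists_between_notMem
      (Finset.univ.val.map x + Finset.univ.val.map p) hlt
    rw [Multiset.mem_add, not_or] at h3
    have := (hc y ((hApos _ (hxm i)).trans h1) h3.1 h3.2).1
    have e1 := le_card_filter p hp y i h2
    have e2 := card_filter_le x hx y i h1
    omega
  · intro i j hij
    by_contra hcon
    have hlt : p i < x j := lt_of_le_of_ne (not_lt.1 hcon) (hne j i).symm
    obtain ⟨y, h1, h2, h3⟩ := exists_between_notMem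
      (Finset.univ.val.map x + Finset.univ.val.map p) hlt
    rw [Multiset.mem_add, not_or] at h3
    have := (hc y ((hBpos _ (hpm i)).trans_lt h1) h3.1 h3.2).2
    have e1 := le_card_filter x hx y j h2
    have e2 := card_filter_le p hp y i h1
    omega

noncomputable def argSum (M : Multiset ℝ) (z : ℂ) : ℝ := (M.map fun y : ℝ => Complex.arg (z - (y : ℂ))).sum

noncomputable def prodAt (M : Multiset ℝ) (z : ℂ) : ℂ := (M.map fun y : ℝ => z - (y : ℂ)).prod

lemma argSum_cons (a : ℝ) (M : Multiset ℝ) (z : ℂ) :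
    argSum (a ::ₘ M) z = Complex.arg (z - (a : ℂ)) + argSum M z := by simp [argSum]

lemma prodAt_cons (a : ℝ) (M : Multiset ℝ) (z : ℂ) :
    prodAt (a ::ₘ M) z = (z - (a : ℂ)) * prodAt M z := by simp [prodAt]

lemma prodAt_eq (M : Multiset ℝ) (z : ℂ) :
    prodAt M z = (‖prodAt M z‖ : ℂ) * Complex.exp (argSum M z * I) := by
  induction M using Multiset.induction with
  | empty => simp [prodAt, argSum]
  | cons a M ih =>
    rw [prodAt_cons, argSum_cons, norm_mul]
    push_cast
    rw [add_mul, Complex.exp_add]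
    calc (z - (a : ℂ)) * prodAt M z
        = ((‖z - (a : ℂ)‖ : ℂ) * Complex.exp (Complex.arg (z - (a : ℂ)) * I)) *
          ((‖prodAt M z‖ : ℂ) * Complex.exp (argSum M z * I)) := by
          rw [Complex.norm_mul_exp_arg_mul_I, ← ih]
      _ = _ := by ring

lemma prodAt_ne_zero (M : Multiset ℝ) (z : ℂ) (hz : 0 < z.im) : prodAt M z ≠ 0 := by
  induction M using Multiset.induction with
  | empty => simp [prodAt]
  | cons a M ih =>
    rw [prodAt_cons]
    refine mul_ne_zero (fun h => ?_) ih
    have := congrArg Complex.im h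
    simp at this
    linarith

lemma argSum_continuousOn (M : Multiset ℝ) : ContinuousOn (argSum M) {z : ℂ | 0 < z.im} := by
  induction M using Multiset.induction with
  | empty =>
    have : argSum 0 = fun _ => (0 : ℝ) := funext fun z => by simp [argSum]
    rw [this]
    exact continuousOn_const
  | cons a M ih =>
    have : argSum (a ::ₘ M) = fun z => Complex.arg (z - (a : ℂ)) + argSum M z :=
      funext fun z => argSum_cons a M z
    rw [this]
    refine ContinuousOn.add ?_ ih
    intro z hz
    apply ContinuousAt.continuousWithinAt
    refine ContinuousAt.comp (f := fun z : ℂ => z - (a : ℂ)) (Complex.continuousAt_arg ?_)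
      (by fun_prop)
    right
    have : (0 : ℝ) < z.im := hz
    simpa using this.ne'

lemma argSum_tendsto_top (M : Multiset ℝ) :
    Tendsto (fun t : ℝ => argSum M (t * I)) atTop (nhds (M.card * (Real.pi / 2))) := by
  induction M using Multiset.induction with
  | empty => simp [argSum]
  | cons a M ih =>
    simp only [argSum_cons, Multiset.card_cons]
    have e : ((M.card + 1 : ℕ) : ℝ) * (Real.pi / 2) = Real.pi / 2 + M.card * (Real.pi / 2) := by
      push_cast; ring
    rw [e]
    refine Tendsto.add ?_ ih
    have h1 : Tendsto (fun t : ℝ => I - ((a / t : ℝ) : ℂ)) atTop (nhds I) := by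
      have : Tendsto (fun t : ℝ => ((a / t : ℝ) : ℂ)) atTop (nhds ((0 : ℝ) : ℂ)) :=
        (Complex.continuous_ofReal.tendsto 0).comp (tendsto_const_nhds.div_atTop tendsto_id)
      simpa using tendsto_const_nhds.sub this
    have h2 : Tendsto (fun t : ℝ => Complex.arg (I - ((a / t : ℝ) : ℂ))) atTop
        (nhds (Complex.arg I)) :=
      (Complex.continuousAt_arg (by simp [Complex.mem_slitPlane_iff])).tendsto.comp h1
    rw [Complex.arg_I] at h2
    refine h2.congr' ?_
    filter_upwards [eventually_gt_atTop 0] with t ht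
    rw [← Complex.arg_real_mul _ ht]
    congr 1
    have : (t : ℂ) ≠ 0 := by exact_mod_cast ht.ne'
    push_cast
    field_simp

lemma argSum_tendsto_real (M : Multiset ℝ) (x : ℝ) (hx : x ∉ M) :
    Tendsto (fun t : ℝ => argSum M (x + t * I)) (nhdsWithin 0 (Set.Ioi 0))
      (nhds ((M.filter (x < ·)).card * Real.pi)) := by
  induction M using Multiset.induction with
  | empty => simp [argSum]
  | cons a M ih =>
    rw [Multiset.mem_cons, not_or] at hx
    have ih := ih hx.2
    simp only [argSum_cons]
    have hlim : Tendsto (fun t : ℝ => (x : ℂ) + t * I - a) (nhdsWithin 0 (Set.Ioi 0))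
        (nhds (((x - a : ℝ)) : ℂ)) := by
      have hcont : Continuous (fun t : ℝ => (x : ℂ) + t * I - a) := by fun_prop
      have := (hcont.tendsto 0).mono_left (nhdsWithin_le_nhds (s := Set.Ioi (0 : ℝ)))
      simpa using this
    rcases lt_or_gt_of_ne hx.1 with h | h
    · rw [Multiset.filter_cons_of_pos _ h, Multiset.card_cons]
      have e : (((M.filter (x < ·)).card + 1 : ℕ) : ℝ) * Real.pi
        = Real.pi + (M.filter (x < ·)).card * Real.pi := by push_cast; ring
      rw [e]
      refine Tendsto.add ?_ ih
      have hc := Complex.continuousWithinAt_arg_of_re_neg_of_im_zero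
        (z := ((x - a : ℝ) : ℂ)) (by simpa using h) (by simp)
      have h3 := hc.tendsto
      rw [Complex.arg_ofReal_of_neg (by linarith)] at h3
      refine h3.comp (tendsto_nhdsWithin_iff.2 ⟨hlim, ?_⟩)
      filter_upwards [self_mem_nhdsWithin] with t ht
      have : (0 : ℝ) < t := ht
      simpa using this.le
    · rw [Multiset.filter_cons_of_neg _ (not_lt.2 h.le)]
      rw [← zero_add (((M.filter (x < ·)).card : ℝ) * Real.pi)]
      refine Tendsto.add ?_ ih
      have hc := Complex.continuousAt_arg (x := ((x - a : ℝ) : ℂ))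
        (Complex.ofReal_mem_slitPlane.2 (by linarith))
      have h3 := hc.tendsto
      rw [Complex.arg_ofReal_of_nonneg (by linarith)] at h3
      exact h3.comp hlim

lemma arg_count (Y Q : Multiset ℝ) (hcard : Y.card = Q.card + 2)
    (h : ∀ z : ℂ, 0 < z.im → ∀ r : ℝ, 0 < r → prodAt Y z ≠ r * prodAt Q z)
    (x : ℝ) (hxY : x ∉ Y) (hxQ : x ∉ Q) :
    (Q.filter (x < ·)).card ≤ (Y.filter (x < ·)).card ∧
      (Y.filter (x < ·)).card ≤ (Q.filter (x < ·)).card + 2 := by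
  set Θ : ℂ → ℝ := fun z => argSum Y z - argSum Q z with hΘ
  have hcont : ContinuousOn Θ {z : ℂ | 0 < z.im} :=
    (argSum_continuousOn Y).sub (argSum_continuousOn Q)
  have hpre : IsPreconnected {z : ℂ | 0 < z.im} := (convex_halfSpace_im_gt 0).isPreconnected
  have hoc : (Θ '' {z : ℂ | 0 < z.im}).OrdConnected := (hpre.image _ hcont).ordConnected
  have havoid : ∀ z : ℂ, 0 < z.im → Complex.exp (Θ z * I) ≠ 1 := by
    intro z hz he
    have hY := prodAt_ne_zero Y z hz
    have hQ := prodAt_ne_zero Q z hz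
    refine h z hz (‖prodAt Y z‖ / ‖prodAt Q z‖)
      (div_pos (norm_pos_iff.2 hY) (norm_pos_iff.2 hQ)) ?_
    have hQ' : (‖prodAt Q z‖ : ℂ) ≠ 0 := by exact_mod_cast (norm_pos_iff.2 hQ).ne'
    have e : Complex.exp (argSum Y z * I) = Complex.exp (argSum Q z * I) := by
      have : (argSum Y z * I : ℂ) = Θ z * I + argSum Q z * I := by
        simp only [hΘ]; push_cast; ring
      rw [this, Complex.exp_add, he, one_mul]
    have e1 := prodAt_eq Y z
    have e2 := prodAt_eq Q z
    rw [e] at e1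
    generalize Complex.exp (argSum Q z * I) = w at e1 e2
    push_cast
    calc prodAt Y z = ‖prodAt Y z‖ * w := e1
      _ = (‖prodAt Y z‖ / ‖prodAt Q z‖ : ℂ) * (‖prodAt Q z‖ * w) := by field_simp
      _ = _ := by rw [← e2]
  have h0 : ∀ z : ℂ, 0 < z.im → Θ z ≠ 0 := fun z hz he => havoid z hz (by simp [he])
  have h2 : ∀ z : ℂ, 0 < z.im → Θ z ≠ 2 * Real.pi := fun z hz he => havoid z hz (by
    rw [he]; push_cast; exact Complex.exp_two_pi_mul_I)
  have hpi := Real.pi_pos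
  have htop : Tendsto (fun t : ℝ => Θ (t * I)) atTop (nhds Real.pi) := by
    have := (argSum_tendsto_top Y).sub (argSum_tendsto_top Q)
    rw [hcard] at this
    convert this using 2
    push_cast; ring
  obtain ⟨t0, ht0, ht0'⟩ := ((htop.eventually (Ioo_mem_nhds hpi
    (by linarith : Real.pi < 2 * Real.pi))).and (eventually_gt_atTop 0)).exists
  have hm : (0 : ℝ) < ((t0 : ℂ) * I).im := by simpa using ht0'
  have hrange : ∀ z : ℂ, 0 < z.im → Θ z ∈ Set.Icc 0 (2 * Real.pi) := by
    intro z hz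
    constructor
    · by_contra hcon
      obtain ⟨w, hw, hw'⟩ := hoc.out (Set.mem_image_of_mem _ hz) (Set.mem_image_of_mem _ hm)
        ⟨(not_le.1 hcon).le, ht0.1.le⟩
      exact h0 w hw hw'
    · by_contra hcon
      obtain ⟨w, hw, hw'⟩ := hoc.out (Set.mem_image_of_mem _ hm) (Set.mem_image_of_mem _ hz)
        ⟨ht0.2.le, (not_le.1 hcon).le⟩
      exact h2 w hw hw'
  have hlim := (argSum_tendsto_real Y x hxY).sub (argSum_tendsto_real Q x hxQ)
  have hmem := isClosed_Icc.mem_of_tendsto hlim (b := nhdsWithin 0 (Set.Ioi 0))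
    (s := Set.Icc 0 (2 * Real.pi)) (by
      filter_upwards [self_mem_nhdsWithin] with t ht
      have : (0 : ℝ) < t := ht
      exact hrange (x + t * I) (by simpa using this))
  rw [← sub_mul] at hmem
  obtain ⟨m1, m2⟩ := hmem
  have n1 := nonneg_of_mul_nonneg_left m1 hpi
  have n2 := le_of_mul_le_mul_right m2 hpi
  constructor
  · have : ((Q.filter (x < ·)).card : ℝ) ≤ (Y.filter (x < ·)).card := by linarith
    exact_mod_cast this
  · have : ((Y.filter (x < ·)).card : ℝ) ≤ (Q.filter (x < ·)).card + 2 := by linarith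
    exact_mod_cast this

lemma exists_pos_value (A B : ℂ[X]) (hA : A ≠ 0) (z₀ : ℂ) (hA0 : A.eval z₀ = 0)
    (hB0 : B.eval z₀ ≠ 0) (hz : z₀.im ≠ 0) :
    ∃ z : ℂ, z.im ≠ 0 ∧ B.eval z ≠ 0 ∧ ∃ r : ℝ, 0 < r ∧ A.eval z = r * B.eval z := by
  set g : ℂ → ℂ := fun z => A.eval z / B.eval z with hg
  have hgan : AnalyticAt ℂ g z₀ := by
    refine AnalyticAt.div ?_ ?_ hB0
    · exact (Polynomial.differentiable A).analyticAt z₀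
    · exact (Polynomial.differentiable B).analyticAt z₀
  have hg0 : g z₀ = 0 := by simp [hg, hA0]
  have hBev : ∀ᶠ z in nhds z₀, B.eval z ≠ 0 := B.continuous.continuousAt.eventually_ne hB0
  have himev : ∀ᶠ z : ℂ in nhds z₀, z.im ≠ 0 := Complex.continuous_im.continuousAt.eventually_ne hz
  rcases hgan.eventually_constant_or_nhds_le_map_nhds with h | h
  · exfalso
    apply hA
    have hev : ∀ᶠ z in nhds z₀, A.eval z = 0 := by
      filter_upwards [h, hBev] with z hz hz'
      rw [hg0] at hz
      simpa [hg, hz'] using hz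
    have hinf : Set.Infinite {z : ℂ | A.eval z = 0} := infinite_of_mem_nhds z₀ hev
    exact Polynomial.eq_zero_of_infinite_isRoot A hinf
  · rw [hg0] at h
    have hmem : g '' {z | B.eval z ≠ 0 ∧ z.im ≠ 0} ∈ nhds (0 : ℂ) :=
      h (image_mem_map (hBev.and himev))
    have ht : Tendsto (fun r : ℝ => (r : ℂ)) (nhdsWithin 0 (Set.Ioi 0)) (nhds 0) := by
      have := (Complex.continuous_ofReal.tendsto 0).mono_left
        (nhdsWithin_le_nhds (s := Set.Ioi (0 : ℝ)))
      simpa using this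
    obtain ⟨r, ⟨z, hz1, hz2⟩, hr⟩ := ((ht.eventually hmem).and
      (self_mem_nhdsWithin (s := Set.Ioi (0 : ℝ)))).exists
    refine ⟨z, hz1.2, hz1.1, r, hr, ?_⟩
    rw [← hz2]
    simp only [hg]
    rw [div_mul_cancel₀ _ hz1.1]

lemma symm_of_disjoint (Z P : Multiset ℝ) (hd : ∀ a ∈ Z, a ∉ P)
    (h : Z.map (fun a => -a) + P = Z + P.map (fun a => -a)) :
    Z.map (fun a => -a) = Z ∧ P.map (fun a => -a) = P := by
  have hcn : ∀ (M : Multiset ℝ) (a : ℝ), (M.map (fun a => -a)).count a = M.count (-a) := by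
    intro M a
    have := Multiset.count_map_eq_count' (fun a : ℝ => -a) M neg_injective (-a)
    simpa using this
  have hcount : ∀ a, Z.count (-a) + P.count a = Z.count a + P.count (-a) := by
    intro a
    have := congrArg (Multiset.count a) h
    simpa [Multiset.count_add, hcn] using this
  have hdis : ∀ a, Z.count a ≠ 0 → P.count a = 0 := by
    intro a ha
    rw [Multiset.count_ne_zero] at ha
    exact Multiset.count_eq_zero.2 (hd a ha)
  have hZ : ∀ a, Z.count (-a) = Z.count a := by
    intro a
    have h1 := hcount a
    have h2 := hdis a
    have h3 := hdis (-a)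
    omega
  have hZ' : Z.map (fun a => -a) = Z := by
    ext a; rw [hcn, hZ]
  refine ⟨hZ', ?_⟩
  rw [hZ'] at h
  exact (add_left_cancel h).symm


lemma tendsto_div_pow (p : ℂ[X]) :
    Tendsto (fun z : ℂ => p.eval z / z ^ p.natDegree) (Bornology.cobounded ℂ)
      (nhds p.leadingCoeff) := by
  have h1 : ∀ z : ℂ, p.eval z / z ^ p.natDegree
      = ∑ i ∈ Finset.range (p.natDegree + 1), p.coeff i * (z ^ i / z ^ p.natDegree) := by
    intro z
    rw [Polynomial.eval_eq_sum_range, Finset.sum_div]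
    exact Finset.sum_congr rfl fun i _ => mul_div_assoc _ _ _
  have hne : ∀ᶠ z : ℂ in Bornology.cobounded ℂ, z ≠ 0 := by
    have := (tendsto_norm_cobounded_atTop (E := ℂ)).eventually (eventually_gt_atTop 0)
    filter_upwards [this] with z hz
    exact norm_pos_iff.1 hz
  simp only [h1]
  have h2 : p.leadingCoeff
      = ∑ i ∈ Finset.range (p.natDegree + 1), p.coeff i * (if i = p.natDegree then 1 else 0) := by
    rw [Polynomial.leadingCoeff]
    simp only [mul_ite, mul_one, mul_zero]
    rw [Finset.sum_ite_eq' _ _ (fun i => p.coeff i)]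
    simp
  rw [h2]
  refine tendsto_finsetSum _ fun i hi => ?_
  refine tendsto_const_nhds.mul ?_
  split_ifs with h
  · rw [h]
    refine tendsto_const_nhds.congr' ?_
    filter_upwards [hne] with z hz
    rw [div_self (pow_ne_zero _ hz)]
  · rw [Finset.mem_range] at hi
    obtain ⟨k, hk⟩ : ∃ k, p.natDegree = i + (k + 1) := ⟨p.natDegree - i - 1, by omega⟩
    have h3 : Tendsto (fun z : ℂ => (z⁻¹) ^ (k + 1)) (Bornology.cobounded ℂ) (nhds 0) := by
      have := (tendsto_inv₀_cobounded (α := ℂ)).pow (k + 1)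
      simpa using this
    refine h3.congr' ?_
    filter_upwards [hne] with z hz
    have hz1 : z ^ i ≠ 0 := pow_ne_zero _ hz
    rw [hk, pow_add z i (k + 1), inv_pow, div_mul_cancel_left₀ hz1]

lemma lim_aux (n d : ℂ[X]) (hd : d.Monic) (L : ℂ) (hL : L ≠ 0)
    (h : Tendsto (fun z : ℂ => n.eval z / d.eval z)
      (Filter.comap (fun z : ℂ => ‖z‖) Filter.atTop) (nhds L)) :
    n.natDegree = d.natDegree ∧ n.leadingCoeff = L := by
  rw [comap_norm_atTop] at h
  have hne : ∀ᶠ z : ℂ in Bornology.cobounded ℂ, z ≠ 0 := by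
    have := (tendsto_norm_cobounded_atTop (E := ℂ)).eventually (eventually_gt_atTop 0)
    filter_upwards [this] with z hz
    exact norm_pos_iff.1 hz
  have hn0 : n ≠ 0 := by
    rintro rfl
    simp only [Polynomial.eval_zero, zero_div] at h
    exact hL (tendsto_nhds_unique h tendsto_const_nhds)
  have hnl : n.leadingCoeff ≠ 0 := by simpa using hn0
  have hn := tendsto_div_pow n
  have hdd := tendsto_div_pow d
  rw [hd.leadingCoeff] at hdd
  have hr := hn.div hdd one_ne_zero
  rw [div_one] at hr
  have hpow : ∀ k : ℕ, Tendsto (fun z : ℂ => (z⁻¹) ^ (k + 1)) (Bornology.cobounded ℂ) (nhds 0) := by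
    intro k
    have := (tendsto_inv₀_cobounded (α := ℂ)).pow (k + 1)
    simpa using this
  have hdeg : n.natDegree = d.natDegree := by
    rcases lt_trichotomy n.natDegree d.natDegree with hlt | heq | hgt
    · exfalso
      obtain ⟨k, hk⟩ : ∃ k, d.natDegree = n.natDegree + (k + 1) :=
        ⟨d.natDegree - n.natDegree - 1, by omega⟩
      have h4 := hr.mul (hpow k)
      rw [mul_zero] at h4
      refine hL (tendsto_nhds_unique h (h4.congr' ?_))
      filter_upwards [hne] with z hz
      simp only [Pi.div_apply]
      rw [hk, pow_add z n.natDegree (k + 1), inv_pow]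
      by_cases hdz : d.eval z = 0
      · simp [hdz]
      have hz1 : z ^ (k + 1) ≠ 0 := pow_ne_zero _ hz
      generalize z ^ (k + 1) = w at hz1
      field_simp
    · exact heq
    · exfalso
      obtain ⟨k, hk⟩ : ∃ k, n.natDegree = d.natDegree + (k + 1) :=
        ⟨n.natDegree - d.natDegree - 1, by omega⟩
      have h4 := h.mul (hpow k)
      rw [mul_zero] at h4
      refine hnl (tendsto_nhds_unique hr (h4.congr' ?_))
      filter_upwards [hne] with z hz
      simp only [Pi.div_apply]
      rw [hk, pow_add z d.natDegree (k + 1), inv_pow]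
      by_cases hdz : d.eval z = 0
      · simp [hdz]
      have hz1 : z ^ (k + 1) ≠ 0 := pow_ne_zero _ hz
      generalize z ^ (k + 1) = w at hz1
      field_simp
  refine ⟨hdeg, tendsto_nhds_unique hr (h.congr' ?_)⟩
  filter_upwards [hne] with z hz
  simp only [Pi.div_apply]
  rw [hdeg, div_div_div_cancel_right₀ (pow_ne_zero _ hz)]

noncomputable def polyOf (Z : Multiset ℝ) : ℂ[X] := (Z.map fun y : ℝ => X - C (y : ℂ)).prod

lemma polyOf_add (Z P : Multiset ℝ) : polyOf (Z + P) = polyOf Z * polyOf P := by simp [polyOf]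

lemma eval_polyOf (Z : Multiset ℝ) (z : ℂ) : (polyOf Z).eval z = prodAt Z z := by
  simp [polyOf, prodAt, Polynomial.eval_multiset_prod]

lemma natDegree_polyOf (Z : Multiset ℝ) : (polyOf Z).natDegree = Z.card := by
  have : polyOf Z = ((Z.map (fun y : ℝ => (y : ℂ))).map fun a => X - C a).prod := by
    rw [polyOf, Multiset.map_map]; rfl
  rw [this, Polynomial.natDegree_multiset_prod_X_sub_C_eq_card, Multiset.card_map]

lemma monic_polyOf (Z : Multiset ℝ) : (polyOf Z).Monic :=
  Polynomial.monic_multiset_prod_of_monic _ _ fun _ _ => Polynomial.monic_X_sub_C _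

lemma prodAt_eq_zero_iff (Z : Multiset ℝ) (z : ℂ) : prodAt Z z = 0 ↔ ∃ y ∈ Z, z = (y : ℂ) := by
  rw [prodAt, Multiset.prod_eq_zero_iff]
  simp [sub_eq_zero]

lemma prodAt_real_eq_zero_iff (Z : Multiset ℝ) (x : ℝ) : prodAt Z (x : ℂ) = 0 ↔ x ∈ Z := by
  rw [prodAt_eq_zero_iff]
  constructor
  · rintro ⟨y, hy, h⟩
    rwa [Complex.ofReal_injective h]
  · intro h; exact ⟨x, h, rfl⟩

noncomputable def rprod (Z : Multiset ℝ) (x : ℝ) : ℝ := (Z.map fun y : ℝ => x - y).prod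

lemma prodAt_ofReal (Z : Multiset ℝ) (x : ℝ) : prodAt Z (x : ℂ) = (rprod Z x : ℂ) := by
  induction Z using Multiset.induction with
  | empty => simp [prodAt, rprod]
  | cons a M ih => rw [prodAt_cons, ih]; simp [rprod]

lemma rprod_neg (Z : Multiset ℝ) (x : ℝ) :
    rprod (Z.map fun a => -a) x = (-1) ^ Z.card * rprod Z (-x) := by
  induction Z using Multiset.induction with
  | empty => simp [rprod]
  | cons a M ih =>
    simp only [rprod, Multiset.map_cons, Multiset.prod_cons, Multiset.card_cons] at ih ⊢
    rw [ih, pow_succ]; ring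

lemma exists_polyOf (p : ℂ[X]) (h : ∀ z : ℂ, p.eval z = 0 → z.im = 0) (hp : p ≠ 0) :
    ∃ Z : Multiset ℝ, p = C p.leadingCoeff * polyOf Z := by
  refine ⟨p.roots.map Complex.re, ?_⟩
  have h1 := (IsAlgClosed.splits p).eq_prod_roots
  conv_lhs => rw [h1]
  rw [polyOf, Multiset.map_map]
  congr 2
  refine Multiset.map_congr rfl fun z hz => ?_
  have := h z ((Polynomial.mem_roots hp).1 hz)
  simp only [Function.comp]
  congr 2
  apply Complex.ext <;> simp [this]

lemma ratfunc_struct (ε : RatFunc ℂ) (ε₀ : ℝ) (hε₀ : 0 < ε₀)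
    (hεlim : Tendsto (fun z : ℂ => RatFunc.eval (RingHom.id ℂ) z ε)
      (Filter.comap (fun z : ℂ => ‖z‖) Filter.atTop) (nhds (ε₀ : ℂ)))
    (hεreal : ∀ z : ℂ, Polynomial.eval z ε.denom ≠ 0 →
      RatFunc.eval (RingHom.id ℂ) (-(starRingEnd ℂ z)) ε
        = starRingEnd ℂ (RatFunc.eval (RingHom.id ℂ) z ε))
    (hn : ∀ z : ℂ, ε.num.eval z = 0 → z.im = 0) (hd : ∀ z : ℂ, ε.denom.eval z = 0 → z.im = 0) :
    ∃ Z P : Multiset ℝ, ε.num = C (ε₀ : ℂ) * polyOf Z ∧ ε.denom = polyOf P ∧ Z.card = P.card ∧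
      (∀ a ∈ Z, a ∉ P) ∧ Z.map (fun a => -a) = Z ∧ P.map (fun a => -a) = P := by
  have hε₀' : (ε₀ : ℂ) ≠ 0 := by exact_mod_cast hε₀.ne'
  obtain ⟨hdeg, hlead⟩ := lim_aux ε.num ε.denom ε.monic_denom ε₀ hε₀' hεlim
  have hnum0 : ε.num ≠ 0 := by
    intro h; rw [h, Polynomial.leadingCoeff_zero] at hlead; exact hε₀' hlead.symm
  obtain ⟨Z, hZ⟩ := exists_polyOf _ hn hnum0
  obtain ⟨P, hP⟩ := exists_polyOf _ hd ε.denom_ne_zero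
  rw [hlead] at hZ
  rw [ε.monic_denom.leadingCoeff, C_1, one_mul] at hP
  have hcard : Z.card = P.card := by
    rw [hZ, hP, Polynomial.natDegree_C_mul hε₀', natDegree_polyOf, natDegree_polyOf] at hdeg
    exact hdeg
  have hdis : ∀ a ∈ Z, a ∉ P := by
    intro a ha ha'
    obtain ⟨u, v, huv⟩ := ε.isCoprime_num_denom
    have := congrArg (Polynomial.eval (a : ℂ)) huv
    rw [hZ, hP] at this
    simp [eval_polyOf, (prodAt_real_eq_zero_iff Z a).2 ha,
      (prodAt_real_eq_zero_iff P a).2 ha'] at this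
  have hev : ∀ z : ℂ, RatFunc.eval (RingHom.id ℂ) z ε = ε₀ * prodAt Z z / prodAt P z := by
    intro z
    rw [RatFunc.eval, ← Polynomial.eval, ← Polynomial.eval, hZ, hP]
    simp [eval_polyOf]
  refine ⟨Z, P, hZ, hP, hcard, hdis, symm_of_disjoint Z P hdis ?_⟩
  have hpoly : ((Z.map (fun a => -a) + P).map fun a : ℝ => (X - C a : ℝ[X])).prod
      = ((Z + P.map (fun a => -a)).map fun a : ℝ => (X - C a : ℝ[X])).prod := by
    apply Polynomial.eq_of_infinite_eval_eq
    have hinf : (Set.univ \ ((P + P.map (fun a => -a)).toFinset : Set ℝ)).Infinite :=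
      Set.infinite_univ.sdiff (Finset.finite_toSet _)
    refine hinf.mono ?_
    rintro x ⟨-, hx⟩
    have hxP : x ∉ P := fun h => hx (by simp [h])
    have hxP' : -x ∉ P := fun h => hx (by
      simp only [Finset.mem_coe, Multiset.mem_toFinset, Multiset.mem_add, Multiset.mem_map]
      exact Or.inr ⟨-x, h, neg_neg x⟩)
    have hr := hεreal x (by
      rw [hP, eval_polyOf]; exact fun h => hxP ((prodAt_real_eq_zero_iff P x).1 h))
    have hPx : rprod P x ≠ 0 := by
      intro h; apply hxP; rw [← prodAt_real_eq_zero_iff, prodAt_ofReal, h]; simp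
    have hPx' : rprod P (-x) ≠ 0 := by
      intro h; apply hxP'; rw [← prodAt_real_eq_zero_iff, prodAt_ofReal, h]; simp
    have e : -(starRingEnd ℂ (x : ℂ)) = ((-x : ℝ) : ℂ) := by simp
    rw [e, hev, hev, prodAt_ofReal, prodAt_ofReal, prodAt_ofReal, prodAt_ofReal] at hr
    have hr' : ((ε₀ * rprod Z (-x) / rprod P (-x) : ℝ) : ℂ)
        = ((ε₀ * rprod Z x / rprod P x : ℝ) : ℂ) := by
      push_cast
      rw [hr]
      simp
    have hr'' := Complex.ofReal_injective hr'
    rw [div_eq_div_iff hPx' hPx] at hr''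
    have hr3 : rprod Z (-x) * rprod P x = rprod Z x * rprod P (-x) := by
      apply mul_left_cancel₀ hε₀.ne'
      linarith
    have hE : ∀ M : Multiset ℝ, Polynomial.eval x ((M.map fun a : ℝ => (X - C a : ℝ[X])).prod)
        = rprod M x := by
      intro M
      simp [rprod, Polynomial.eval_multiset_prod]
    have hadd : ∀ M N : Multiset ℝ, rprod (M + N) x = rprod M x * rprod N x := by
      intro M N; simp [rprod]
    change Polynomial.eval x _ = Polynomial.eval x _
    rw [hE, hE, hadd, hadd, rprod_neg, rprod_neg, hcard]
    linear_combination (-1) ^ P.card * hr3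
  have := congrArg Polynomial.roots hpoly
  rwa [Polynomial.roots_multiset_prod_X_sub_C, Polynomial.roots_multiset_prod_X_sub_C] at this

lemma symm_decomp (R : Multiset ℝ) (h : R.map (fun a => -a) = R) :
    R = R.filter (0 < ·) + ((R.filter (0 < ·)).map (fun a => -a) + Multiset.replicate (R.count 0) 0) := by
  have h1 : R.filter (· < 0) = (R.filter (0 < ·)).map (fun a => -a) := by
    conv_lhs => rw [← h]
    rw [Multiset.filter_map]
    congr 1
    apply Multiset.filter_congr
    intro a _
    simp
  rw [← h1]
  ext a
  simp only [Multiset.count_add, Multiset.count_filter, Multiset.count_replicate]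
  rcases lt_trichotomy a 0 with ha | ha | ha
  · simp [ha, ha.le, ha.ne']
  · simp [ha]
  · simp [ha, ha.le, ha.ne]

lemma symm_card (R : Multiset ℝ) (h : R.map (fun a => -a) = R) :
    R.card = R.count 0 + 2 * (R.filter (0 < ·)).card := by
  have := congrArg Multiset.card (symm_decomp R h)
  simp only [Multiset.card_add, Multiset.card_map, Multiset.card_replicate] at this
  omega

lemma symm_polyOf (R : Multiset ℝ) (h : R.map (fun a => -a) = R) :
    polyOf R = X ^ R.count 0 *
      ((R.filter (0 < ·)).map fun y : ℝ => (X ^ 2 - C ((y : ℂ) ^ 2) : ℂ[X])).prod := by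
  have key : ∀ M : Multiset ℝ, polyOf M * polyOf (M.map (fun a => -a))
      = (M.map fun y : ℝ => (X ^ 2 - C ((y : ℂ) ^ 2) : ℂ[X])).prod := by
    intro M
    rw [polyOf, polyOf, Multiset.map_map, ← Multiset.prod_map_mul]
    congr 1
    refine Multiset.map_congr rfl fun y _ => ?_
    simp
    ring
  conv_lhs => rw [symm_decomp R h]
  rw [polyOf_add, polyOf_add, ← mul_assoc, key, mul_comm]
  congr 1
  simp [polyOf]

lemma filter_pos_eq (M : Multiset ℝ) : ∃ y : ℝ, 0 < y ∧ ∀ a ∈ M, 0 < a → y < a := by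
  induction M using Multiset.induction with
  | empty => exact ⟨1, one_pos, by simp⟩
  | cons a M ih =>
    obtain ⟨y, hy, h⟩ := ih
    by_cases ha : 0 < a
    · refine ⟨min y (a / 2), lt_min hy (by linarith), ?_⟩
      intro b hb hb0
      rcases Multiset.mem_cons.1 hb with rfl | hb
      · exact (min_le_right _ _).trans_lt (by linarith)
      · exact (min_le_left _ _).trans_lt (h b hb hb0)
    · refine ⟨y, hy, ?_⟩
      intro b hb hb0
      rcases Multiset.mem_cons.1 hb with rfl | hb
      · exact absurd hb0 ha
      · exact h b hb hb0

lemma nondeg_aux (μ : RatFunc ℂ) (z : ℂ) (h : Polynomial.eval z (RatFunc.X * μ).num ≠ 0) :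
    μ.num.eval z ≠ 0 ∧ (z = 0 → μ.denom.eval z = 0) := by
  have hm := congrArg (Polynomial.eval z) (RatFunc.num_denom_mul RatFunc.X μ)
  simp only [Polynomial.eval_mul, RatFunc.denom_X, RatFunc.num_X, Polynomial.eval_X, one_mul] at hm
  constructor
  · intro h0
    have hd : μ.denom.eval z ≠ 0 := by
      intro hd
      obtain ⟨u, v, huv⟩ := μ.isCoprime_num_denom
      have := congrArg (Polynomial.eval z) huv
      simp [h0, hd] at this
    rw [h0] at hm
    simp [h, hd] at hm
  · rintro rfl
    simpa [h] using hm

lemma core (Zε Pε Zμ Pμ : Multiset ℝ) (c : ℝ) (hc : 0 < c)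
    (hcε : Zε.card = Pε.card) (hcμ : Zμ.card = Pμ.card)
    (hdε : ∀ a ∈ Zε, a ∉ Pε) (hdμ : ∀ a ∈ Zμ, a ∉ Pμ)
    (hdεμ : ∀ a ∈ Zε, a ∉ Pμ) (hdμε : ∀ a ∈ Zμ, a ∉ Pε)
    (hsZε : Zε.map (fun a => -a) = Zε) (hsPε : Pε.map (fun a => -a) = Pε)
    (hsZμ : Zμ.map (fun a => -a) = Zμ) (hsPμ : Pμ.map (fun a => -a) = Pμ)
    (h0 : (0 : ℝ) ∈ Pε ↔ (0 : ℝ) ∈ Pμ)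
    (hnd : ∀ z : ℂ, 0 < z.im → ∀ r : ℝ, 0 < r →
      z ^ 2 * prodAt (Zε + Zμ) z ≠ r * prodAt (Pε + Pμ) z) :
    ∃ (εs μs : RatFunc ℂ) (εs₀ μs₀ : ℝ),
      IsGeneralizedLorentz εs εs₀ ∧ IsGeneralizedLorentz μs μs₀ ∧
      εs * μs = algebraMap ℂ[X] (RatFunc ℂ) (C (c : ℂ) * polyOf (Zε + Zμ)) /
        algebraMap ℂ[X] (RatFunc ℂ) (polyOf (Pε + Pμ)) ∧
      IsHerglotz (fun z : ℂ => z * RatFunc.eval (RingHom.id ℂ) z εs) ∧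
      IsHerglotz (fun z : ℂ => z * RatFunc.eval (RingHom.id ℂ) z μs) := by
  obtain ⟨Z, hZdef⟩ : ∃ Z, Z = Zε + Zμ := ⟨_, rfl⟩
  obtain ⟨P, hPdef⟩ : ∃ P, P = Pε + Pμ := ⟨_, rfl⟩
  have hsZ : Z.map (fun a => -a) = Z := by rw [hZdef, Multiset.map_add, hsZε, hsZμ]
  have hsP : P.map (fun a => -a) = P := by rw [hPdef, Multiset.map_add, hsPε, hsPμ]
  have hd : ∀ a ∈ Z, a ∉ P := by
    intro a ha ha'
    rw [hZdef, Multiset.mem_add] at ha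
    rw [hPdef, Multiset.mem_add] at ha'
    rcases ha with ha | ha <;> rcases ha' with ha' | ha'
    · exact hdε a ha ha'
    · exact hdεμ a ha ha'
    · exact hdμε a ha ha'
    · exact hdμ a ha ha'
  have hcount : ∀ y : ℝ, 0 < y → y ∉ Z → y ∉ P →
      (P.filter (y < ·)).card ≤ (Z.filter (y < ·)).card ∧
      (Z.filter (y < ·)).card ≤ (P.filter (y < ·)).card + 2 := by
    intro y hy hyZ hyP
    have := arg_count (0 ::ₘ 0 ::ₘ Z) P
      (by rw [Multiset.card_cons, Multiset.card_cons, hZdef, hPdef, Multiset.card_add,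
        Multiset.card_add]; omega)
      (by
        intro z hz r hr
        rw [prodAt_cons, prodAt_cons, hZdef, hPdef]
        have := hnd z hz r hr
        intro h
        apply this
        rw [← h]; simp; ring) y
      (by simp [hy.ne', hyZ]) hyP
    rw [Multiset.filter_cons_of_neg _ (not_lt.2 hy.le),
      Multiset.filter_cons_of_neg _ (not_lt.2 hy.le)] at this
    exact this
  -- numbers of positive zeros and poles
  have hnum : (P.filter (0 < ·)).card ≤ (Z.filter (0 < ·)).card ∧
      (Z.filter (0 < ·)).card ≤ (P.filter (0 < ·)).card + 2 := by
    obtain ⟨y, hy, hyM⟩ := filter_pos_eq (Z + P)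
    have := hcount y hy (fun h => lt_irrefl _ (hyM y (by simp [h]) hy))
      (fun h => lt_irrefl _ (hyM y (by simp [h]) hy))
    rwa [Multiset.filter_congr (s := P) (q := (0 < ·))
        (fun a ha => ⟨fun h => hy.trans h, fun h => hyM a (by simp [ha]) h⟩),
      Multiset.filter_congr (s := Z) (q := (0 < ·))
        (fun a ha => ⟨fun h => hy.trans h, fun h => hyM a (by simp [ha]) h⟩)] at this
  have hnumbers : Z.count 0 = 0 ∧ P.count 0 = 2 * (P.count 0 / 2) ∧
      (Z.filter (0 < ·)).card = (P.filter (0 < ·)).card + P.count 0 / 2 := by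
    have k1 := symm_card Zε hsZε
    have k2 := symm_card Zμ hsZμ
    have k3 := symm_card Pε hsPε
    have k4 := symm_card Pμ hsPμ
    rw [hZdef, hPdef] at hnum ⊢
    simp only [Multiset.filter_add, Multiset.card_add, Multiset.count_add] at hnum ⊢
    have c1 : 0 < Pε.count 0 ↔ 0 < Pμ.count 0 := by
      rw [Multiset.count_pos, Multiset.count_pos]; exact h0
    have c2 : 0 < Zε.count 0 → Pε.count 0 = 0 := fun h =>
      Multiset.count_eq_zero.2 (hdε _ (Multiset.count_pos.1 h))
    have c3 : 0 < Zμ.count 0 → Pμ.count 0 = 0 := fun h =>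
      Multiset.count_eq_zero.2 (hdμ _ (Multiset.count_pos.1 h))
    omega
  obtain ⟨hn1, hn2, hn3⟩ := hnumbers
  obtain ⟨A, hA⟩ : ∃ A, A = Z.filter (0 < ·) := ⟨_, rfl⟩
  obtain ⟨B, hB⟩ : ∃ B, B = P.filter (0 < ·) + Multiset.replicate (P.count 0 / 2) 0 := ⟨_, rfl⟩
  have hZpoly : polyOf Z = (A.map fun y : ℝ => (X ^ 2 - C ((y : ℂ) ^ 2) : ℂ[X])).prod := by
    rw [symm_polyOf Z hsZ, hn1, pow_zero, one_mul, hA]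
  have hPpoly : polyOf P = (B.map fun y : ℝ => (X ^ 2 - C ((y : ℂ) ^ 2) : ℂ[X])).prod := by
    rw [symm_polyOf P hsP, hB, Multiset.map_add, Multiset.prod_add, mul_comm, Multiset.map_replicate,
      Multiset.prod_replicate]
    congr 1
    conv_lhs => rw [hn2]
    simp [pow_mul]
  obtain ⟨x, p, hx, hxA, hpB, hp0, hpx, hxp⟩ := interlace A B A.card rfl
    (by rw [hA, hB, Multiset.card_add, Multiset.card_replicate, hn3])
    (by intro a ha; rw [hA] at ha; exact (Multiset.mem_filter.1 ha).2)
    (by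
      intro b hb
      rw [hB, Multiset.mem_add] at hb
      rcases hb with hb | hb
      · exact (Multiset.mem_filter.1 hb).2.le
      · rw [Multiset.eq_of_mem_replicate hb])
    (by
      intro a ha hb
      rw [hA, Multiset.mem_filter] at ha
      rw [hB, Multiset.mem_add] at hb
      rcases hb with hb | hb
      · exact hd a ha.1 (Multiset.mem_filter.1 hb).1
      · exact ha.2.ne' (Multiset.eq_of_mem_replicate hb))
    (by
      intro y hy hyA hyB
      have hyZ : y ∉ Z := fun h => hyA (by rw [hA, Multiset.mem_filter]; exact ⟨h, hy⟩)
      have hyP : y ∉ P := fun h => hyB (by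
        rw [hB, Multiset.mem_add, Multiset.mem_filter]; exact Or.inl ⟨h, hy⟩)
      have e : ∀ M : Multiset ℝ, (M.filter (0 < ·)).filter (y < ·) = M.filter (y < ·) := by
        intro M
        rw [Multiset.filter_filter]
        exact Multiset.filter_congr fun a _ => ⟨fun h => h.1, fun h => ⟨h, hy.trans h⟩⟩
      have e0 : (Multiset.replicate (P.count 0 / 2) (0 : ℝ)).filter (y < ·) = 0 := by
        rw [Multiset.filter_eq_nil]
        intro a ha
        rw [Multiset.eq_of_mem_replicate ha]
        exact not_lt.2 hy.le
      rw [hA, hB, Multiset.filter_add, e, e, e0, add_zero]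
      exact hcount y hy hyZ hyP)
  have hZprod : polyOf Z = ∏ i, (X ^ 2 - C ((x i : ℂ) ^ 2)) := by
    rw [hZpoly]; conv_lhs => rw [← hxA]
    rw [Multiset.map_map]; rfl
  have hPprod : polyOf P = ∏ i, (X ^ 2 - C ((p i : ℂ) ^ 2)) := by
    rw [hPpoly]; conv_lhs => rw [← hpB]
    rw [Multiset.map_map]; rfl
  obtain ⟨S, hS⟩ : ∃ S : Finset (Fin A.card), S = Finset.univ.filter (fun i : Fin A.card => (i : ℕ) % 2 = 0) :=
    ⟨_, rfl⟩
  obtain ⟨T, hT⟩ : ∃ T : Finset (Fin A.card), T = Finset.univ.filter (fun i : Fin A.card => ¬ (i : ℕ) % 2 = 0) :=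
    ⟨_, rfl⟩
  have hST : ∀ g : Fin A.card → ℂ[X], (∏ i ∈ S, g i) * ∏ i ∈ T, g i = ∏ i, g i := by
    intro g; rw [hS, hT]; exact Finset.prod_filter_mul_prod_filter_not _ _ _
  have r1 := lorentz_aux S x p (fun i _ => hp0 i) (fun i _ => hpx i)
    (fun i hi j hj hij => hxp i j (by
      rw [hS, Finset.mem_filter] at hi hj
      have : (i : ℕ) < j := hij
      omega)) c hc _ _ rfl rfl _ rfl
  have r2 := lorentz_aux T x p (fun i _ => hp0 i) (fun i _ => hpx i)
    (fun i hi j hj hij => hxp i j (by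
      rw [hT, Finset.mem_filter] at hi hj
      have : (i : ℕ) < j := hij
      omega)) 1 one_pos _ _ rfl rfl _ rfl
  refine ⟨_, _, c, 1, r1.1, r2.1, ?_, r1.2, r2.2⟩
  rw [← hZdef, ← hPdef, hZprod, hPprod, div_mul_div_comm, ← map_mul, ← map_mul, hST]
  congr 2
  simp only [Complex.ofReal_one, C_1, one_mul]
  rw [mul_assoc, hST]
/-- A non-degenerate non-dissipative local material `(ε, μ)` is equivalent to a passive,
generalized Lorentz material `(ε*, μ*)`: `ε* μ* = ε μ` as rational functions; in particular
`ω ε*(ω)` and `ω μ*(ω)` are Herglotz functions. -/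
theorem nondissipative_equiv_passive
    (ε μ : RatFunc ℂ) (ε₀ μ₀ : ℝ) (hε₀ : 0 < ε₀) (hμ₀ : 0 < μ₀)
    (hεlim : Tendsto (fun z : ℂ => RatFunc.eval (RingHom.id ℂ) z ε)
      (Filter.comap (fun z : ℂ => ‖z‖) Filter.atTop) (nhds (ε₀ : ℂ)))
    (hμlim : Tendsto (fun z : ℂ => RatFunc.eval (RingHom.id ℂ) z μ)
      (Filter.comap (fun z : ℂ => ‖z‖) Filter.atTop) (nhds (μ₀ : ℂ)))
    (hεreal : ∀ z : ℂ, Polynomial.eval z ε.denom ≠ 0 →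
      RatFunc.eval (RingHom.id ℂ) (-(starRingEnd ℂ z)) ε
        = starRingEnd ℂ (RatFunc.eval (RingHom.id ℂ) z ε))
    (hμreal : ∀ z : ℂ, Polynomial.eval z μ.denom ≠ 0 →
      RatFunc.eval (RingHom.id ℂ) (-(starRingEnd ℂ z)) μ
        = starRingEnd ℂ (RatFunc.eval (RingHom.id ℂ) z μ))
    -- non-degeneracy
    (hnd₁ : ∀ z : ℂ, Polynomial.eval z ε.denom = 0 →
      Polynomial.eval z (RatFunc.X * μ).num ≠ 0)
    (hnd₂ : ∀ z : ℂ, Polynomial.eval z μ.denom = 0 →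
      Polynomial.eval z (RatFunc.X * ε).num ≠ 0)
    -- non-dissipativity
    (hnondis : ∀ r : ℝ, 0 < r → ∀ ω : ℂ,
      Polynomial.eval ω ε.denom ≠ 0 → Polynomial.eval ω μ.denom ≠ 0 →
      ω ^ 2 * RatFunc.eval (RingHom.id ℂ) ω ε * RatFunc.eval (RingHom.id ℂ) ω μ = (r : ℂ) →
      ω.im = 0) :
    ∃ (εs μs : RatFunc ℂ) (εs₀ μs₀ : ℝ),
      IsGeneralizedLorentz εs εs₀ ∧ IsGeneralizedLorentz μs μs₀ ∧
      εs * μs = ε * μ ∧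
      IsHerglotz (fun z : ℂ => z * RatFunc.eval (RingHom.id ℂ) z εs) ∧
      IsHerglotz (fun z : ℂ => z * RatFunc.eval (RingHom.id ℂ) z μs) := by
  set E_n := ε.num with hEn
  set E_d := ε.denom with hEd
  set M_n := μ.num with hMn
  set M_d := μ.denom with hMd
  have hεev : ∀ z : ℂ, RatFunc.eval (RingHom.id ℂ) z ε = E_n.eval z / E_d.eval z := fun z => rfl
  have hμev : ∀ z : ℂ, RatFunc.eval (RingHom.id ℂ) z μ = M_n.eval z / M_d.eval z := fun z => rfl
  have hε₀' : (ε₀ : ℂ) ≠ 0 := by exact_mod_cast hε₀.ne'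
  have hμ₀' : (μ₀ : ℂ) ≠ 0 := by exact_mod_cast hμ₀.ne'
  have hcopε : ∀ z : ℂ, E_n.eval z = 0 → E_d.eval z ≠ 0 := by
    intro z h0 hd
    obtain ⟨u, v, huv⟩ := ε.isCoprime_num_denom
    have := congrArg (Polynomial.eval z) huv
    rw [← hEn, ← hEd] at this
    simp [h0, hd] at this
  have hcopμ : ∀ z : ℂ, M_n.eval z = 0 → M_d.eval z ≠ 0 := by
    intro z h0 hd
    obtain ⟨u, v, huv⟩ := μ.isCoprime_num_denom
    have := congrArg (Polynomial.eval z) huv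
    rw [← hMn, ← hMd] at this
    simp [h0, hd] at this
  have hEn0 : E_n ≠ 0 := by
    intro h
    have := (lim_aux E_n E_d ε.monic_denom ε₀ hε₀' hεlim).2
    rw [h, Polynomial.leadingCoeff_zero] at this
    exact hε₀' this.symm
  have hMn0 : M_n ≠ 0 := by
    intro h
    have := (lim_aux M_n M_d μ.monic_denom μ₀ hμ₀' hμlim).2
    rw [h, Polynomial.leadingCoeff_zero] at this
    exact hμ₀' this.symm
  have hEd0 : E_d ≠ 0 := ε.denom_ne_zero
  have hMd0 : M_d ≠ 0 := μ.denom_ne_zero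
  have hx1 : ∀ z, E_d.eval z = 0 → M_n.eval z ≠ 0 := fun z hz => (nondeg_aux μ z (hnd₁ z hz)).1
  have hx2 : ∀ z, M_d.eval z = 0 → E_n.eval z ≠ 0 := fun z hz => (nondeg_aux ε z (hnd₂ z hz)).1
  have hx3 : E_d.eval 0 = 0 ↔ M_d.eval 0 = 0 :=
    ⟨fun h => (nondeg_aux μ 0 (hnd₁ 0 h)).2 rfl, fun h => (nondeg_aux ε 0 (hnd₂ 0 h)).2 rfl⟩
  have hnd' : ∀ z : ℂ, z.im ≠ 0 → (E_d * M_d).eval z ≠ 0 → ∀ r : ℝ, 0 < r →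
      (X ^ 2 * (E_n * M_n)).eval z ≠ r * (E_d * M_d).eval z := by
    intro z hz hD r hr h
    rw [Polynomial.eval_mul] at hD
    have h1 := left_ne_zero_of_mul hD
    have h2 := right_ne_zero_of_mul hD
    refine hz (hnondis r hr z h1 h2 ?_)
    rw [hεev, hμev]
    simp only [Polynomial.eval_mul, Polynomial.eval_pow, Polynomial.eval_X] at h
    rw [mul_assoc, div_mul_div_comm, ← mul_div_assoc, div_eq_iff hD]
    exact h
  have hzero : ∀ z : ℂ, (X ^ 2 * (E_n * M_n)).eval z = 0 → (E_d * M_d).eval z ≠ 0 → z.im = 0 := by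
    intro z h1 h2
    by_contra hz
    obtain ⟨w, hw1, hw2, r, hr, hw3⟩ := exists_pos_value (X ^ 2 * (E_n * M_n)) (E_d * M_d)
      (mul_ne_zero (pow_ne_zero _ X_ne_zero) (mul_ne_zero hEn0 hMn0)) z h1 h2 hz
    exact hnd' w hw1 hw2 r hr hw3
  have hpole : ∀ z : ℂ, (E_d * M_d).eval z = 0 → (X ^ 2 * (E_n * M_n)).eval z ≠ 0 → z.im = 0 := by
    intro z h1 h2
    by_contra hz
    obtain ⟨w, hw1, hw2, r, hr, hw3⟩ := exists_pos_value (E_d * M_d) (X ^ 2 * (E_n * M_n))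
      (mul_ne_zero hEd0 hMd0) z h1 h2 hz
    have hr' : (r : ℂ) ≠ 0 := by exact_mod_cast hr.ne'
    refine hnd' w hw1 ?_ r⁻¹ (inv_pos.2 hr) ?_
    · rw [hw3]; exact mul_ne_zero hr' hw2
    · rw [hw3]; push_cast; rw [inv_mul_cancel_left₀ hr']
  have hEnr : ∀ z : ℂ, E_n.eval z = 0 → z.im = 0 := by
    intro z hz
    refine hzero z (by simp [hz]) ?_
    rw [Polynomial.eval_mul]
    exact mul_ne_zero (hcopε z hz) (fun h => hx2 z h hz)
  have hMnr : ∀ z : ℂ, M_n.eval z = 0 → z.im = 0 := by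
    intro z hz
    refine hzero z (by simp [hz]) ?_
    rw [Polynomial.eval_mul]
    exact mul_ne_zero (fun h => hx1 z h hz) (hcopμ z hz)
  have hEdr : ∀ z : ℂ, E_d.eval z = 0 → z.im = 0 := by
    intro z hz
    by_cases h0 : z = 0
    · simp [h0]
    refine hpole z (by simp [hz]) ?_
    simp only [Polynomial.eval_mul, Polynomial.eval_pow, Polynomial.eval_X]
    exact mul_ne_zero (pow_ne_zero _ h0) (mul_ne_zero (fun h => hcopε z h hz) (hx1 z hz))
  have hMdr : ∀ z : ℂ, M_d.eval z = 0 → z.im = 0 := by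
    intro z hz
    by_cases h0 : z = 0
    · simp [h0]
    refine hpole z (by simp [hz]) ?_
    simp only [Polynomial.eval_mul, Polynomial.eval_pow, Polynomial.eval_X]
    exact mul_ne_zero (pow_ne_zero _ h0) (mul_ne_zero (hx2 z hz) (fun h => hcopμ z h hz))
  obtain ⟨Zε, Pε, hZε, hPε, hcε, hdε, hsZε, hsPε⟩ :=
    ratfunc_struct ε ε₀ hε₀ hεlim hεreal hEnr hEdr
  obtain ⟨Zμ, Pμ, hZμ, hPμ, hcμ, hdμ, hsZμ, hsPμ⟩ :=
    ratfunc_struct μ μ₀ hμ₀ hμlim hμreal hMnr hMdr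
  rw [← hEn] at hZε
  rw [← hEd] at hPε
  rw [← hMn] at hZμ
  rw [← hMd] at hPμ
  have hN : E_n * M_n = C ((ε₀ * μ₀ : ℝ) : ℂ) * polyOf (Zε + Zμ) := by
    rw [hZε, hZμ, polyOf_add]; push_cast; rw [C_mul]; ring
  have hD : E_d * M_d = polyOf (Pε + Pμ) := by rw [hPε, hPμ, polyOf_add]
  have hmem : ∀ (M : Multiset ℝ) (a : ℝ), (polyOf M).eval (a : ℂ) = 0 ↔ a ∈ M := by
    intro M a; rw [eval_polyOf, prodAt_real_eq_zero_iff]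
  have hc : 0 < ε₀ * μ₀ := mul_pos hε₀ hμ₀
  obtain ⟨εs, μs, e0, m0, h1, h2, h3, h4, h5⟩ := core Zε Pε Zμ Pμ (ε₀ * μ₀) hc hcε hcμ hdε hdμ
    (by
      intro a ha ha'
      refine hx2 a (by rw [hPμ, hmem]; exact ha') ?_
      rw [hZε, Polynomial.eval_mul, (hmem Zε a).2 ha, mul_zero])
    (by
      intro a ha ha'
      refine hx1 a (by rw [hPε, hmem]; exact ha') ?_
      rw [hZμ, Polynomial.eval_mul, (hmem Zμ a).2 ha, mul_zero])
    hsZε hsPε hsZμ hsPμ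
    (by
      rw [← hmem, ← hmem, ← hPε, ← hPμ]
      simpa using hx3)
    (by
      intro z hz r hr h
      have hne : (E_d * M_d).eval z ≠ 0 := by
        rw [hD, eval_polyOf]; exact prodAt_ne_zero _ z hz
      refine hnd' z hz.ne' hne (ε₀ * μ₀ * r) (mul_pos hc hr) ?_
      rw [hN, hD]
      simp only [Polynomial.eval_mul, Polynomial.eval_pow, Polynomial.eval_X, Polynomial.eval_C,
        eval_polyOf]
      push_cast
      linear_combination (ε₀ * μ₀ : ℂ) * h)
  refine ⟨εs, μs, e0, m0, h1, h2, ?_, h4, h5⟩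
  rw [h3, ← hN, ← hD, map_mul, map_mul, ← div_mul_div_comm, RatFunc.num_div_denom,
    RatFunc.num_div_denom]
end
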